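/- arXiv:2109.06423 — 2 statements merged into one kernel-verified Lean document; each statement's English description precedes it below -/
import Mathlib

section
/- For any family E of (011→2D)-PI kernels of size n2×(p0,p1) and any family D of (2D→011)-PI kernels of size (p0,p1)×m2, there exists a family Q of 2D-PI kernels of size n2×m2 such that for every continuous u : [a,b]×[c,d] → ℝ^{m2} and every (x,y) ∈ [a,b]×[c,d], (P[E](P[D]u))(x,y) = (P[Q]u)(x,y). That is, the composition of a (2D→011)-PI operator followed by a (011→2D)-PI operator is a 2D-PI operator. -/
open Matrix MeasureTheory Set

noncomputable section

/-- A family of 1D-PI kernels of size `p × r` (the parameters of a 1D-PI operator). -/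
structure PI1DK (p r : ℕ) where
  k0 : ℝ → Matrix (Fin p) (Fin r) ℝ
  k1 : ℝ → ℝ → Matrix (Fin p) (Fin r) ℝ
  k2 : ℝ → ℝ → Matrix (Fin p) (Fin r) ℝ

/-- Continuity of a family of 1D-PI kernels on the interval `[s,t]`. -/
def PI1DK.IsCont {p r : ℕ} (s t : ℝ) (N : PI1DK p r) : Prop :=
  ContinuousOn N.k0 (Icc s t) ∧
  ContinuousOn (fun q : ℝ × ℝ => N.k1 q.1 q.2) (Icc s t ×ˢ Icc s t) ∧
  ContinuousOn (fun q : ℝ × ℝ => N.k2 q.1 q.2) (Icc s t ×ˢ Icc s t)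

/-- The 1D-PI operator on `[s,t]` associated with the kernels `N`. -/
def PI1D {p r : ℕ} (s t : ℝ) (N : PI1DK p r) (u : ℝ → Fin r → ℝ) (x : ℝ) :
    Fin p → ℝ :=
  N.k0 x *ᵥ u x + (∫ θ in s..x, N.k1 x θ *ᵥ u θ) + (∫ θ in x..t, N.k2 x θ *ᵥ u θ)

/-- Entrywise interval integral of a matrix-valued function. -/
def mInt {p r : ℕ} (s t : ℝ) (F : ℝ → Matrix (Fin p) (Fin r) ℝ) :
    Matrix (Fin p) (Fin r) ℝ :=
  Matrix.of fun i j => ∫ η in s..t, F η i j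

/-- A family of 2D-PI kernels of size `p × r`. -/
structure PI2DK (p r : ℕ) where
  k00 : ℝ → ℝ → Matrix (Fin p) (Fin r) ℝ
  k10 : ℝ → ℝ → ℝ → Matrix (Fin p) (Fin r) ℝ
  k20 : ℝ → ℝ → ℝ → Matrix (Fin p) (Fin r) ℝ
  k01 : ℝ → ℝ → ℝ → Matrix (Fin p) (Fin r) ℝ
  k02 : ℝ → ℝ → ℝ → Matrix (Fin p) (Fin r) ℝ
  k11 : ℝ → ℝ → ℝ → ℝ → Matrix (Fin p) (Fin r) ℝ
  k21 : ℝ → ℝ → ℝ → ℝ → Matrix (Fin p) (Fin r) ℝ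
  k12 : ℝ → ℝ → ℝ → ℝ → Matrix (Fin p) (Fin r) ℝ
  k22 : ℝ → ℝ → ℝ → ℝ → Matrix (Fin p) (Fin r) ℝ

/-- Continuity of a family of 2D-PI kernels on `[a,b] × [c,d]`. -/
def PI2DK.IsCont {p r : ℕ} (a b c d : ℝ) (N : PI2DK p r) : Prop :=
  ContinuousOn (fun q : ℝ × ℝ => N.k00 q.1 q.2) (Icc a b ×ˢ Icc c d) ∧
  ContinuousOn (fun q : ℝ × ℝ × ℝ => N.k10 q.1 q.2.1 q.2.2)
    (Icc a b ×ˢ Icc c d ×ˢ Icc a b) ∧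
  ContinuousOn (fun q : ℝ × ℝ × ℝ => N.k20 q.1 q.2.1 q.2.2)
    (Icc a b ×ˢ Icc c d ×ˢ Icc a b) ∧
  ContinuousOn (fun q : ℝ × ℝ × ℝ => N.k01 q.1 q.2.1 q.2.2)
    (Icc a b ×ˢ Icc c d ×ˢ Icc c d) ∧
  ContinuousOn (fun q : ℝ × ℝ × ℝ => N.k02 q.1 q.2.1 q.2.2)
    (Icc a b ×ˢ Icc c d ×ˢ Icc c d) ∧
  ContinuousOn (fun q : ℝ × ℝ × ℝ × ℝ => N.k11 q.1 q.2.1 q.2.2.1 q.2.2.2)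
    (Icc a b ×ˢ Icc c d ×ˢ Icc a b ×ˢ Icc c d) ∧
  ContinuousOn (fun q : ℝ × ℝ × ℝ × ℝ => N.k21 q.1 q.2.1 q.2.2.1 q.2.2.2)
    (Icc a b ×ˢ Icc c d ×ˢ Icc a b ×ˢ Icc c d) ∧
  ContinuousOn (fun q : ℝ × ℝ × ℝ × ℝ => N.k12 q.1 q.2.1 q.2.2.1 q.2.2.2)
    (Icc a b ×ˢ Icc c d ×ˢ Icc a b ×ˢ Icc c d) ∧
  ContinuousOn (fun q : ℝ × ℝ × ℝ × ℝ => N.k22 q.1 q.2.1 q.2.2.1 q.2.2.2)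
    (Icc a b ×ˢ Icc c d ×ˢ Icc a b ×ˢ Icc c d)

/-- The 2D-PI operator on `[a,b] × [c,d]` associated with the kernels `N`. -/
def PI2D {p r : ℕ} (a b c d : ℝ) (N : PI2DK p r) (u : ℝ → ℝ → Fin r → ℝ)
    (x y : ℝ) : Fin p → ℝ :=
  N.k00 x y *ᵥ u x y
  + (∫ θ in a..x, N.k10 x y θ *ᵥ u θ y)
  + (∫ θ in x..b, N.k20 x y θ *ᵥ u θ y)
  + (∫ ν in c..y, N.k01 x y ν *ᵥ u x ν)
  + (∫ ν in y..d, N.k02 x y ν *ᵥ u x ν)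
  + (∫ θ in a..x, ∫ ν in c..y, N.k11 x y θ ν *ᵥ u θ ν)
  + (∫ θ in x..b, ∫ ν in c..y, N.k21 x y θ ν *ᵥ u θ ν)
  + (∫ θ in a..x, ∫ ν in y..d, N.k12 x y θ ν *ᵥ u θ ν)
  + (∫ θ in x..b, ∫ ν in y..d, N.k22 x y θ ν *ᵥ u θ ν)

/-- A family of 011-PI kernels of size `(p0,p1) × (r0,r1)`. -/
structure PI011K (p0 p1 r0 r1 : ℕ) where
  b00 : Matrix (Fin p0) (Fin r0) ℝ
  b01 : ℝ → Matrix (Fin p0) (Fin r1) ℝ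
  b02 : ℝ → Matrix (Fin p0) (Fin r1) ℝ
  b10 : ℝ → Matrix (Fin p1) (Fin r0) ℝ
  b20 : ℝ → Matrix (Fin p1) (Fin r0) ℝ
  b12 : ℝ → ℝ → Matrix (Fin p1) (Fin r1) ℝ
  b21 : ℝ → ℝ → Matrix (Fin p1) (Fin r1) ℝ
  b11 : PI1DK p1 r1
  b22 : PI1DK p1 r1

/-- Continuity of a family of 011-PI kernels. -/
def PI011K.IsCont {p0 p1 r0 r1 : ℕ} (a b c d : ℝ) (B : PI011K p0 p1 r0 r1) : Prop :=
  ContinuousOn B.b01 (Icc a b) ∧ ContinuousOn B.b02 (Icc c d) ∧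
  ContinuousOn B.b10 (Icc a b) ∧ ContinuousOn B.b20 (Icc c d) ∧
  ContinuousOn (fun q : ℝ × ℝ => B.b12 q.1 q.2) (Icc a b ×ˢ Icc c d) ∧
  ContinuousOn (fun q : ℝ × ℝ => B.b21 q.1 q.2) (Icc c d ×ˢ Icc a b) ∧
  B.b11.IsCont a b ∧ B.b22.IsCont c d

/-- The 011-PI operator associated with the kernels `B`. -/
def PI011 {p0 p1 r0 r1 : ℕ} (a b c d : ℝ) (B : PI011K p0 p1 r0 r1)
    (v : Fin r0 → ℝ) (u1 u2 : ℝ → Fin r1 → ℝ) :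
    (Fin p0 → ℝ) × (ℝ → Fin p1 → ℝ) × (ℝ → Fin p1 → ℝ) :=
  ( B.b00 *ᵥ v + (∫ θ in a..b, B.b01 θ *ᵥ u1 θ) + (∫ ν in c..d, B.b02 ν *ᵥ u2 ν),
    fun x => B.b10 x *ᵥ v + PI1D a b B.b11 u1 x + (∫ ν in c..d, B.b12 x ν *ᵥ u2 ν),
    fun y => B.b20 y *ᵥ v + (∫ θ in a..b, B.b21 y θ *ᵥ u1 θ) + PI1D c d B.b22 u2 y )

/-- A family of (2D→011)-PI kernels of size `(p0,p1) × r`. -/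
structure PI2Dto011K (p0 p1 r : ℕ) where
  d0 : ℝ → ℝ → Matrix (Fin p0) (Fin r) ℝ
  d10 : ℝ → ℝ → Matrix (Fin p1) (Fin r) ℝ
  d11 : ℝ → ℝ → ℝ → Matrix (Fin p1) (Fin r) ℝ
  d12 : ℝ → ℝ → ℝ → Matrix (Fin p1) (Fin r) ℝ
  d20 : ℝ → ℝ → Matrix (Fin p1) (Fin r) ℝ
  d21 : ℝ → ℝ → ℝ → Matrix (Fin p1) (Fin r) ℝ
  d22 : ℝ → ℝ → ℝ → Matrix (Fin p1) (Fin r) ℝ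

/-- Continuity of a family of (2D→011)-PI kernels. -/
def PI2Dto011K.IsCont {p0 p1 r : ℕ} (a b c d : ℝ) (D : PI2Dto011K p0 p1 r) : Prop :=
  ContinuousOn (fun q : ℝ × ℝ => D.d0 q.1 q.2) (Icc a b ×ˢ Icc c d) ∧
  ContinuousOn (fun q : ℝ × ℝ => D.d10 q.1 q.2) (Icc a b ×ˢ Icc c d) ∧
  ContinuousOn (fun q : ℝ × ℝ × ℝ => D.d11 q.1 q.2.1 q.2.2)
    (Icc a b ×ˢ Icc c d ×ˢ Icc a b) ∧
  ContinuousOn (fun q : ℝ × ℝ × ℝ => D.d12 q.1 q.2.1 q.2.2)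
    (Icc a b ×ˢ Icc c d ×ˢ Icc a b) ∧
  ContinuousOn (fun q : ℝ × ℝ => D.d20 q.1 q.2) (Icc a b ×ˢ Icc c d) ∧
  ContinuousOn (fun q : ℝ × ℝ × ℝ => D.d21 q.1 q.2.1 q.2.2)
    (Icc a b ×ˢ Icc c d ×ˢ Icc c d) ∧
  ContinuousOn (fun q : ℝ × ℝ × ℝ => D.d22 q.1 q.2.1 q.2.2)
    (Icc a b ×ˢ Icc c d ×ˢ Icc c d)

/-- The (2D→011)-PI operator associated with the kernels `D`. -/
def PI2Dto011 {p0 p1 r : ℕ} (a b c d : ℝ) (D : PI2Dto011K p0 p1 r)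
    (u : ℝ → ℝ → Fin r → ℝ) :
    (Fin p0 → ℝ) × (ℝ → Fin p1 → ℝ) × (ℝ → Fin p1 → ℝ) :=
  ( ∫ θ in a..b, ∫ ν in c..d, D.d0 θ ν *ᵥ u θ ν,
    fun x => ∫ y in c..d,
      (D.d10 x y *ᵥ u x y + (∫ θ in a..x, D.d11 x y θ *ᵥ u θ y)
        + (∫ θ in x..b, D.d12 x y θ *ᵥ u θ y)),
    fun y => ∫ x in a..b,
      (D.d20 x y *ᵥ u x y + (∫ ν in c..y, D.d21 x y ν *ᵥ u x ν)
        + (∫ ν in y..d, D.d22 x y ν *ᵥ u x ν)) )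

/-- A family of (011→2D)-PI kernels of size `p × (r0,r1)`. -/
structure PI011to2DK (p r0 r1 : ℕ) where
  e0 : ℝ → ℝ → Matrix (Fin p) (Fin r0) ℝ
  e10 : ℝ → ℝ → Matrix (Fin p) (Fin r1) ℝ
  e11 : ℝ → ℝ → ℝ → Matrix (Fin p) (Fin r1) ℝ
  e12 : ℝ → ℝ → ℝ → Matrix (Fin p) (Fin r1) ℝ
  e20 : ℝ → ℝ → Matrix (Fin p) (Fin r1) ℝ
  e21 : ℝ → ℝ → ℝ → Matrix (Fin p) (Fin r1) ℝ
  e22 : ℝ → ℝ → ℝ → Matrix (Fin p) (Fin r1) ℝ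

/-- Continuity of a family of (011→2D)-PI kernels. -/
def PI011to2DK.IsCont {p r0 r1 : ℕ} (a b c d : ℝ) (E : PI011to2DK p r0 r1) : Prop :=
  ContinuousOn (fun q : ℝ × ℝ => E.e0 q.1 q.2) (Icc a b ×ˢ Icc c d) ∧
  ContinuousOn (fun q : ℝ × ℝ => E.e10 q.1 q.2) (Icc a b ×ˢ Icc c d) ∧
  ContinuousOn (fun q : ℝ × ℝ × ℝ => E.e11 q.1 q.2.1 q.2.2)
    (Icc a b ×ˢ Icc c d ×ˢ Icc a b) ∧
  ContinuousOn (fun q : ℝ × ℝ × ℝ => E.e12 q.1 q.2.1 q.2.2)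
    (Icc a b ×ˢ Icc c d ×ˢ Icc a b) ∧
  ContinuousOn (fun q : ℝ × ℝ => E.e20 q.1 q.2) (Icc a b ×ˢ Icc c d) ∧
  ContinuousOn (fun q : ℝ × ℝ × ℝ => E.e21 q.1 q.2.1 q.2.2)
    (Icc a b ×ˢ Icc c d ×ˢ Icc c d) ∧
  ContinuousOn (fun q : ℝ × ℝ × ℝ => E.e22 q.1 q.2.1 q.2.2)
    (Icc a b ×ˢ Icc c d ×ˢ Icc c d)

/-- The (011→2D)-PI operator associated with the kernels `E`. -/
def PI011to2D {p r0 r1 : ℕ} (a b c d : ℝ) (E : PI011to2DK p r0 r1)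
    (v : Fin r0 → ℝ) (u1 u2 : ℝ → Fin r1 → ℝ) (x y : ℝ) : Fin p → ℝ :=
  E.e0 x y *ᵥ v + E.e10 x y *ᵥ u1 x
  + (∫ θ in a..x, E.e11 x y θ *ᵥ u1 θ) + (∫ θ in x..b, E.e12 x y θ *ᵥ u1 θ)
  + E.e20 x y *ᵥ u2 y
  + (∫ ν in c..y, E.e21 x y ν *ᵥ u2 ν) + (∫ ν in y..d, E.e22 x y ν *ᵥ u2 ν)

section IntervalIntegral

variable {X G : Type*} [TopologicalSpace X] [NormedAddCommGroup G] [NormedSpace ℝ G]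

theorem continuous_intervalIntegral_of_continuous [FirstCountableTopology X]
    [LocallyCompactSpace X] {f : X → ℝ → G} {s t : X → ℝ}
    (hf : Continuous fun q : X × ℝ => f q.1 q.2) (hs : Continuous s) (ht : Continuous t) :
    Continuous fun x => ∫ η in s x..t x, f x η := by
  have h : ∀ x, ∫ η in s x..t x, f x η
      = (∫ η in (0 : ℝ)..t x, f x η) - ∫ η in (0 : ℝ)..s x, f x η :=
    fun x => by
      have hx : Continuous (f x) := by fun_prop
      rw [intervalIntegral.integral_interval_sub_left (hx.intervalIntegrable _ _)
        (hx.intervalIntegrable _ _)]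
  simp_rw [h]
  exact (intervalIntegral.continuous_parametric_intervalIntegral_of_continuous hf ht).sub
    (intervalIntegral.continuous_parametric_intervalIntegral_of_continuous hf hs)

theorem integral_integral_swap_of_continuous {f : ℝ → ℝ → G}
    (hf : Continuous fun q : ℝ × ℝ => f q.1 q.2) (s t α β : ℝ) :
    ∫ η in s..t, ∫ θ in α..β, f η θ = ∫ θ in α..β, ∫ η in s..t, f η θ := by
  apply intervalIntegral_intervalIntegral_swap
  have h : IntegrableOn f.uncurry (uIcc s t ×ˢ uIcc α β) :=
    ContinuousOn.integrableOn_compact (isCompact_uIcc.prod isCompact_uIcc) hf.continuousOn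
  exact h.mono_set (prod_mono uIoc_subset_uIcc uIoc_subset_uIcc)

theorem integral_integral_swap_triangle {f : ℝ → ℝ → G}
    (hf : Continuous fun q : ℝ × ℝ => f q.1 q.2) {s t : ℝ} (hst : s ≤ t) :
    ∫ η in s..t, ∫ θ in s..η, f η θ = ∫ θ in s..t, ∫ η in θ..t, f η θ := by
  set T : Set (ℝ × ℝ) := {q | q.2 ≤ q.1}
  have hT : MeasurableSet T := measurableSet_le measurable_snd measurable_fst
  set F : ℝ → ℝ → G := fun η θ => T.indicator (fun q => f q.1 q.2) (η, θ)
  have hF : IntegrableOn F.uncurry (uIoc s t ×ˢ uIoc s t) := by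
    have h : IntegrableOn (fun q : ℝ × ℝ => f q.1 q.2) (uIcc s t ×ˢ uIcc s t) :=
      ContinuousOn.integrableOn_compact (isCompact_uIcc.prod isCompact_uIcc) hf.continuousOn
    exact (h.mono_set (prod_mono uIoc_subset_uIcc uIoc_subset_uIcc)).indicator hT
  have h1 : ∫ η in s..t, ∫ θ in s..η, f η θ = ∫ η in s..t, ∫ θ in s..t, F η θ := by
    refine intervalIntegral.integral_congr fun η hη => ?_
    rw [uIcc_of_le hst] at hη
    have : (fun θ => F η θ) = (Iic η).indicator (f η) := by
      ext θ; simp [F, T, indicator_apply]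
    simp only [this, intervalIntegral.integral_of_le hη.1, intervalIntegral.integral_of_le hst]
    rw [setIntegral_indicator measurableSet_Iic, Ioc_inter_Iic, min_eq_right hη.2]
  have h2 : ∫ θ in s..t, ∫ η in θ..t, f η θ = ∫ θ in s..t, ∫ η in s..t, F η θ := by
    refine intervalIntegral.integral_congr_uIoo fun θ hθ => ?_
    rw [uIoo_of_le hst] at hθ
    have : (fun η => F η θ) = (Ici θ).indicator (fun η => f η θ) := by
      ext η; simp [F, T, indicator_apply]
    have hset : Ioc s t ∩ Ici θ = Icc θ t := by
      ext η; simp only [mem_inter_iff, mem_Ioc, mem_Ici, mem_Icc]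
      exact ⟨fun h => ⟨h.2, h.1.2⟩, fun h => ⟨⟨hθ.1.trans_le h.1, h.2⟩, h.1⟩⟩
    simp only [this, intervalIntegral.integral_of_le hθ.2.le, intervalIntegral.integral_of_le hst]
    rw [setIntegral_indicator measurableSet_Ici, hset, integral_Icc_eq_integral_Ioc]
  rw [h1, h2, intervalIntegral_intervalIntegral_swap hF]

end IntervalIntegral

theorem mulVec_intervalIntegral {p r : ℕ} (M : Matrix (Fin p) (Fin r) ℝ) {f : ℝ → Fin r → ℝ}
    (hf : Continuous f) (s t : ℝ) :
    M *ᵥ (∫ η in s..t, f η) = ∫ η in s..t, M *ᵥ f η :=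
  ((LinearMap.toContinuousLinearMap M.mulVecLin).intervalIntegral_comp_comm
    (hf.intervalIntegrable s t)).symm

theorem intervalIntegral_apply {r : ℕ} {f : ℝ → Fin r → ℝ}
    (hf : Continuous f) (s t : ℝ) (i : Fin r) :
    (∫ η in s..t, f η) i = ∫ η in s..t, f η i :=
  ((ContinuousLinearMap.proj (R := ℝ) (φ := fun _ : Fin r => ℝ) i).intervalIntegral_comp_comm
    (hf.intervalIntegrable s t)).symm

theorem mInt_mulVec {p r : ℕ} {F : ℝ → Matrix (Fin p) (Fin r) ℝ} (hF : Continuous F) (s t : ℝ)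
    (v : Fin r → ℝ) : mInt s t F *ᵥ v = ∫ η in s..t, F η *ᵥ v := by
  ext i
  rw [intervalIntegral_apply (by fun_prop)]
  simp only [mInt, mulVec, dotProduct, of_apply]
  rw [intervalIntegral.integral_finsetSum
    fun j _ => Continuous.intervalIntegrable (by fun_prop) _ _]
  simp only [intervalIntegral.integral_mul_const]

theorem continuous_mInt {X : Type*} [TopologicalSpace X] [FirstCountableTopology X]
    [LocallyCompactSpace X] {p r : ℕ} {F : X → ℝ → Matrix (Fin p) (Fin r) ℝ} {s t : X → ℝ}
    (hF : Continuous fun q : X × ℝ => F q.1 q.2) (hs : Continuous s) (ht : Continuous t) :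
    Continuous fun x => mInt (s x) (t x) (F x) :=
  continuous_matrix fun i j =>
    continuous_intervalIntegral_of_continuous (hF.matrix_elem i j) hs ht

/-- Kernels of the composition of two 1D-PI operators on `[s,t]`. -/
def PI1DK.comp {p q r : ℕ} (s t : ℝ) (A : PI1DK p q) (B : PI1DK q r) : PI1DK p r where
  k0 x := A.k0 x * B.k0 x
  k1 x θ := A.k0 x * B.k1 x θ + A.k1 x θ * B.k0 θ + mInt θ x (fun η => A.k1 x η * B.k1 η θ)
    + mInt s θ (fun η => A.k1 x η * B.k2 η θ) + mInt x t (fun η => A.k2 x η * B.k1 η θ)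
  k2 x θ := A.k0 x * B.k2 x θ + A.k2 x θ * B.k0 θ + mInt θ t (fun η => A.k2 x η * B.k1 η θ)
    + mInt s x (fun η => A.k1 x η * B.k2 η θ) + mInt x θ (fun η => A.k2 x η * B.k2 η θ)

/-- Joint continuity of a parametrized family of 1D-PI kernels. -/
structure ContinuousPI1DK {X : Type*} [TopologicalSpace X] {p r : ℕ} (A : X → PI1DK p r) :
    Prop where
  k0 : Continuous fun q : X × ℝ => (A q.1).k0 q.2
  k1 : Continuous fun q : X × ℝ × ℝ => (A q.1).k1 q.2.1 q.2.2
  k2 : Continuous fun q : X × ℝ × ℝ => (A q.1).k2 q.2.1 q.2.2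

namespace ContinuousPI1DK

variable {X Y : Type*} [TopologicalSpace X] [TopologicalSpace Y] {p q r : ℕ}

theorem comp_param {A : X → PI1DK p r} (hA : ContinuousPI1DK A) {f : Y → X} (hf : Continuous f) :
    ContinuousPI1DK fun z => A (f z) where
  k0 := hA.k0.comp (f := fun z : Y × ℝ => (f z.1, z.2)) (by fun_prop)
  k1 := hA.k1.comp (f := fun z : Y × ℝ × ℝ => (f z.1, z.2)) (by fun_prop)
  k2 := hA.k2.comp (f := fun z : Y × ℝ × ℝ => (f z.1, z.2)) (by fun_prop)

theorem continuous_k0 {A : X → PI1DK p r} (hA : ContinuousPI1DK A) {f : Y → X} {g : Y → ℝ}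
    (hf : Continuous f) (hg : Continuous g) : Continuous fun z => (A (f z)).k0 (g z) :=
  hA.k0.comp (f := fun z => (f z, g z)) (by fun_prop)

theorem continuous_k1 {A : X → PI1DK p r} (hA : ContinuousPI1DK A) {f : Y → X} {g h : Y → ℝ}
    (hf : Continuous f) (hg : Continuous g) (hh : Continuous h) :
    Continuous fun z => (A (f z)).k1 (g z) (h z) :=
  hA.k1.comp (f := fun z => (f z, g z, h z)) (by fun_prop)

theorem continuous_k2 {A : X → PI1DK p r} (hA : ContinuousPI1DK A) {f : Y → X} {g h : Y → ℝ}
    (hf : Continuous f) (hg : Continuous g) (hh : Continuous h) :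
    Continuous fun z => (A (f z)).k2 (g z) (h z) :=
  hA.k2.comp (f := fun z => (f z, g z, h z)) (by fun_prop)

theorem comp [FirstCountableTopology X] [LocallyCompactSpace X] {A : X → PI1DK p q}
    {B : X → PI1DK q r} (hA : ContinuousPI1DK A) (hB : ContinuousPI1DK B) (s t : ℝ) :
    ContinuousPI1DK fun z => (A z).comp s t (B z) := by
  refine ⟨hA.k0.matrix_mul hB.k0, ?_, ?_⟩ <;>
    refine ((((?_ : Continuous _).add ?_).add (continuous_mInt ?_ ?_ ?_)).add
      (continuous_mInt ?_ ?_ ?_)).add (continuous_mInt ?_ ?_ ?_)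
  all_goals first
    | fun_prop
    | apply Continuous.matrix_mul <;>
      first
      | (apply hA.continuous_k0 <;> fun_prop)
      | (apply hA.continuous_k1 <;> fun_prop)
      | (apply hA.continuous_k2 <;> fun_prop)
      | (apply hB.continuous_k0 <;> fun_prop)
      | (apply hB.continuous_k1 <;> fun_prop)
      | (apply hB.continuous_k2 <;> fun_prop)

theorem continuous_PI1D [FirstCountableTopology X] [LocallyCompactSpace X] {A : X → PI1DK p r}
    (hA : ContinuousPI1DK A) {u : X → ℝ → Fin r → ℝ}
    (hu : Continuous fun z : X × ℝ => u z.1 z.2) (s t : ℝ) :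
    Continuous fun z : X × ℝ => PI1D s t (A z.1) (u z.1) z.2 := by
  refine ((hA.k0.matrix_mulVec hu).add
    (continuous_intervalIntegral_of_continuous (Continuous.matrix_mulVec ?_ ?_) ?_ ?_)).add
    (continuous_intervalIntegral_of_continuous (Continuous.matrix_mulVec ?_ ?_) ?_ ?_)
  all_goals first
    | fun_prop
    | (apply hA.continuous_k1 <;> fun_prop)
    | (apply hA.continuous_k2 <;> fun_prop)

end ContinuousPI1DK

theorem PI1D_integral {p r : ℕ} {A : PI1DK p r}
    (hA : ContinuousPI1DK fun _ : Unit => A) {w : ℝ → ℝ → Fin r → ℝ}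
    (hw : Continuous fun z : ℝ × ℝ => w z.1 z.2) (s t α β x : ℝ) :
    PI1D s t A (fun η => ∫ ν in α..β, w ν η) x = ∫ ν in α..β, PI1D s t A (w ν) x := by
  have h1 : Continuous fun z : ℝ × ℝ => A.k1 x z.1 *ᵥ w z.2 z.1 :=
    (hA.continuous_k1 (f := fun _ => ()) (by fun_prop) (by fun_prop) (by fun_prop)).matrix_mulVec
      (by fun_prop)
  have h2 : Continuous fun z : ℝ × ℝ => A.k2 x z.1 *ᵥ w z.2 z.1 :=
    (hA.continuous_k2 (f := fun _ => ()) (by fun_prop) (by fun_prop) (by fun_prop)).matrix_mulVec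
      (by fun_prop)
  have hc : ∀ η, Continuous fun ν => w ν η := fun η => by fun_prop
  simp only [PI1D, mulVec_intervalIntegral _ (hc _)]
  rw [integral_integral_swap_of_continuous (f := fun η ν => A.k1 x η *ᵥ w ν η) h1,
    integral_integral_swap_of_continuous (f := fun η ν => A.k2 x η *ᵥ w ν η) h2,
    ← intervalIntegral.integral_add, ← intervalIntegral.integral_add]
  all_goals apply Continuous.intervalIntegrable
  · apply Continuous.add (by fun_prop)
    exact continuous_intervalIntegral_of_continuous
      (h1.comp (f := fun z : ℝ × ℝ => (z.2, z.1)) (by fun_prop)) (by fun_prop) (by fun_prop)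
  · exact continuous_intervalIntegral_of_continuous
      (h2.comp (f := fun z : ℝ × ℝ => (z.2, z.1)) (by fun_prop)) (by fun_prop) (by fun_prop)
  · fun_prop
  · exact continuous_intervalIntegral_of_continuous
      (h1.comp (f := fun z : ℝ × ℝ => (z.2, z.1)) (by fun_prop)) (by fun_prop) (by fun_prop)

theorem integral_mulVec_PI1D {p q r : ℕ} {M : ℝ → Matrix (Fin p) (Fin q) ℝ} (hM : Continuous M)
    {B : PI1DK q r} (hB : ContinuousPI1DK fun _ : Unit => B) {v : ℝ → Fin r → ℝ}
    (hv : Continuous v) (s t α β : ℝ) :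
    ∫ η in α..β, M η *ᵥ PI1D s t B v η =
      (∫ η in α..β, (M η * B.k0 η) *ᵥ v η)
      + (∫ η in α..β, ∫ θ in s..η, (M η * B.k1 η θ) *ᵥ v θ)
      + ∫ η in α..β, ∫ θ in η..t, (M η * B.k2 η θ) *ᵥ v θ := by
  have h0 : Continuous B.k0 :=
    hB.continuous_k0 (f := fun _ => ()) (by fun_prop) (by fun_prop)
  have h1 : Continuous fun z : ℝ × ℝ => B.k1 z.1 z.2 :=
    hB.continuous_k1 (f := fun _ => ()) (by fun_prop) (by fun_prop) (by fun_prop)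
  have h2 : Continuous fun z : ℝ × ℝ => B.k2 z.1 z.2 :=
    hB.continuous_k2 (f := fun _ => ()) (by fun_prop) (by fun_prop) (by fun_prop)
  have h : ∀ η, M η *ᵥ PI1D s t B v η = (M η * B.k0 η) *ᵥ v η
      + (∫ θ in s..η, (M η * B.k1 η θ) *ᵥ v θ) + ∫ θ in η..t, (M η * B.k2 η θ) *ᵥ v θ :=
    fun η => by
      rw [PI1D, mulVec_add, mulVec_add, mulVec_intervalIntegral _ (by fun_prop),
        mulVec_intervalIntegral _ (by fun_prop)]
      simp only [mulVec_mulVec]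
  simp_rw [h]
  have c1 : Continuous fun η => ∫ θ in s..η, (M η * B.k1 η θ) *ᵥ v θ :=
    continuous_intervalIntegral_of_continuous (by fun_prop) (by fun_prop) (by fun_prop)
  have c2 : Continuous fun η => ∫ θ in η..t, (M η * B.k2 η θ) *ᵥ v θ :=
    continuous_intervalIntegral_of_continuous (by fun_prop) (by fun_prop) (by fun_prop)
  rw [intervalIntegral.integral_add, intervalIntegral.integral_add]
  all_goals exact Continuous.intervalIntegrable (by fun_prop) _ _

theorem PI1D_comp {p q r : ℕ} {A : PI1DK p q} {B : PI1DK q r}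
    (hA : ContinuousPI1DK fun _ : Unit => A) (hB : ContinuousPI1DK fun _ : Unit => B)
    {v : ℝ → Fin r → ℝ} (hv : Continuous v) {s t x : ℝ} (hx : x ∈ Icc s t) :
    PI1D s t A (PI1D s t B v) x = PI1D s t (A.comp s t B) v x := by
  have a1 : Continuous (A.k1 x) :=
    hA.continuous_k1 (f := fun _ => ()) (by fun_prop) (by fun_prop) (by fun_prop)
  have a2 : Continuous (A.k2 x) :=
    hA.continuous_k2 (f := fun _ => ()) (by fun_prop) (by fun_prop) (by fun_prop)
  have b0 : Continuous B.k0 :=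
    hB.continuous_k0 (f := fun _ => ()) (by fun_prop) (by fun_prop)
  have b1 : Continuous fun z : ℝ × ℝ => B.k1 z.1 z.2 :=
    hB.continuous_k1 (f := fun _ => ()) (by fun_prop) (by fun_prop) (by fun_prop)
  have b2 : Continuous fun z : ℝ × ℝ => B.k2 z.1 z.2 :=
    hB.continuous_k2 (f := fun _ => ()) (by fun_prop) (by fun_prop) (by fun_prop)
  have cont : ∀ (M : ℝ → Matrix (Fin p) (Fin q) ℝ) (N : ℝ → ℝ → Matrix (Fin q) (Fin r) ℝ)
      (g h : ℝ → ℝ), Continuous M → (Continuous fun z : ℝ × ℝ => N z.1 z.2) → Continuous g →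
      Continuous h → (Continuous fun η => ∫ θ in g η..h η, (M η * N η θ) *ᵥ v θ) ∧
        Continuous fun θ => ∫ η in g θ..h θ, (M η * N η θ) *ᵥ v θ :=
    fun M N g h hM hN hg hh =>
      ⟨continuous_intervalIntegral_of_continuous (by fun_prop) hg hh,
        continuous_intervalIntegral_of_continuous (by fun_prop) hg hh⟩
  have i {f : ℝ → Fin p → ℝ} (hf : Continuous f) (α β : ℝ) :
      IntervalIntegrable f volume α β := hf.intervalIntegrable α β
  have e11 : ∫ η in s..x, ∫ θ in s..η, (A.k1 x η * B.k1 η θ) *ᵥ v θ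
      = ∫ θ in s..x, ∫ η in θ..x, (A.k1 x η * B.k1 η θ) *ᵥ v θ :=
    integral_integral_swap_triangle (by fun_prop) hx.1
  have e22 : ∫ η in x..t, ∫ θ in η..t, (A.k2 x η * B.k2 η θ) *ᵥ v θ
      = ∫ θ in x..t, ∫ η in x..θ, (A.k2 x η * B.k2 η θ) *ᵥ v θ :=
    (integral_integral_swap_triangle (f := fun θ η => (A.k2 x η * B.k2 η θ) *ᵥ v θ)
      (by fun_prop) hx.2).symm
  have e12 : ∫ η in s..x, ∫ θ in η..t, (A.k1 x η * B.k2 η θ) *ᵥ v θ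
      = (∫ θ in s..x, ∫ η in s..θ, (A.k1 x η * B.k2 η θ) *ᵥ v θ)
        + ∫ θ in x..t, ∫ η in s..x, (A.k1 x η * B.k2 η θ) *ᵥ v θ := by
    rw [integral_integral_swap_triangle (f := fun θ η => (A.k1 x η * B.k2 η θ) *ᵥ v θ)
      (by fun_prop) hx.1, integral_integral_swap_of_continuous
        (f := fun θ η => (A.k1 x η * B.k2 η θ) *ᵥ v θ) (by fun_prop),
      ← intervalIntegral.integral_add (i (cont _ _ _ _ a1 b2 (by fun_prop) (by fun_prop)).1 _ _)
        (i (cont _ _ _ _ a1 b2 (by fun_prop) (by fun_prop)).1 _ _)]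
    refine intervalIntegral.integral_congr fun η _ => ?_
    exact (intervalIntegral.integral_add_adjacent_intervals (i (by fun_prop) _ _)
      (i (by fun_prop) _ _)).symm
  have e21 : ∫ η in x..t, ∫ θ in s..η, (A.k2 x η * B.k1 η θ) *ᵥ v θ
      = (∫ θ in s..x, ∫ η in x..t, (A.k2 x η * B.k1 η θ) *ᵥ v θ)
        + ∫ θ in x..t, ∫ η in θ..t, (A.k2 x η * B.k1 η θ) *ᵥ v θ := by
    rw [← integral_integral_swap_triangle (f := fun η θ => (A.k2 x η * B.k1 η θ) *ᵥ v θ)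
      (by fun_prop) hx.2, integral_integral_swap_of_continuous
        (f := fun θ η => (A.k2 x η * B.k1 η θ) *ᵥ v θ) (by fun_prop),
      ← intervalIntegral.integral_add (i (cont _ _ _ _ a2 b1 (by fun_prop) (by fun_prop)).1 _ _)
        (i (cont _ _ _ _ a2 b1 (by fun_prop) (by fun_prop)).1 _ _)]
    refine intervalIntegral.integral_congr fun η _ => ?_
    exact (intervalIntegral.integral_add_adjacent_intervals (i (by fun_prop) _ _)
      (i (by fun_prop) _ _)).symm
  have k1 : ∫ θ in s..x, (A.comp s t B).k1 x θ *ᵥ v θ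
      = (∫ θ in s..x, (A.k0 x * B.k1 x θ) *ᵥ v θ) + (∫ θ in s..x, (A.k1 x θ * B.k0 θ) *ᵥ v θ)
        + (∫ θ in s..x, ∫ η in θ..x, (A.k1 x η * B.k1 η θ) *ᵥ v θ)
        + (∫ θ in s..x, ∫ η in s..θ, (A.k1 x η * B.k2 η θ) *ᵥ v θ)
        + ∫ θ in s..x, ∫ η in x..t, (A.k2 x η * B.k1 η θ) *ᵥ v θ := by
    have c1 := (cont _ _ (fun θ => θ) (fun _ => x) a1 b1 (by fun_prop) (by fun_prop)).2
    have c2 := (cont _ _ (fun _ => s) (fun θ => θ) a1 b2 (by fun_prop) (by fun_prop)).2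
    have c3 := (cont _ _ (fun _ => x) (fun _ => t) a2 b1 (by fun_prop) (by fun_prop)).2
    simp only [PI1DK.comp, add_mulVec]
    simp_rw [fun θ => mInt_mulVec (F := fun η => A.k1 x η * B.k1 η θ) (by fun_prop) θ x (v θ),
      fun θ => mInt_mulVec (F := fun η => A.k1 x η * B.k2 η θ) (by fun_prop) s θ (v θ),
      fun θ => mInt_mulVec (F := fun η => A.k2 x η * B.k1 η θ) (by fun_prop) x t (v θ)]
    rw [intervalIntegral.integral_add, intervalIntegral.integral_add,
      intervalIntegral.integral_add, intervalIntegral.integral_add]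
    all_goals exact i (by fun_prop) _ _
  have k2 : ∫ θ in x..t, (A.comp s t B).k2 x θ *ᵥ v θ
      = (∫ θ in x..t, (A.k0 x * B.k2 x θ) *ᵥ v θ) + (∫ θ in x..t, (A.k2 x θ * B.k0 θ) *ᵥ v θ)
        + (∫ θ in x..t, ∫ η in θ..t, (A.k2 x η * B.k1 η θ) *ᵥ v θ)
        + (∫ θ in x..t, ∫ η in s..x, (A.k1 x η * B.k2 η θ) *ᵥ v θ)
        + ∫ θ in x..t, ∫ η in x..θ, (A.k2 x η * B.k2 η θ) *ᵥ v θ := by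
    have c1 := (cont _ _ (fun θ => θ) (fun _ => t) a2 b1 (by fun_prop) (by fun_prop)).2
    have c2 := (cont _ _ (fun _ => s) (fun _ => x) a1 b2 (by fun_prop) (by fun_prop)).2
    have c3 := (cont _ _ (fun _ => x) (fun θ => θ) a2 b2 (by fun_prop) (by fun_prop)).2
    simp only [PI1DK.comp, add_mulVec]
    simp_rw [fun θ => mInt_mulVec (F := fun η => A.k2 x η * B.k1 η θ) (by fun_prop) θ t (v θ),
      fun θ => mInt_mulVec (F := fun η => A.k1 x η * B.k2 η θ) (by fun_prop) s x (v θ),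
      fun θ => mInt_mulVec (F := fun η => A.k2 x η * B.k2 η θ) (by fun_prop) x θ (v θ)]
    rw [intervalIntegral.integral_add, intervalIntegral.integral_add,
      intervalIntegral.integral_add, intervalIntegral.integral_add]
    all_goals exact i (by fun_prop) _ _
  rw [PI1D, integral_mulVec_PI1D a1 hB hv, integral_mulVec_PI1D a2 hB hv, e11, e12, e21, e22,
    PI1D, mulVec_add, mulVec_add, mulVec_intervalIntegral _ (by fun_prop),
    mulVec_intervalIntegral _ (by fun_prop), PI1D, k1, k2]
  simp only [mulVec_mulVec, PI1DK.comp]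
  abel

theorem PI1D_comp_integral {p q r : ℕ} {A : PI1DK p q} {B : ℝ → PI1DK q r}
    (hA : ContinuousPI1DK fun _ : Unit => A) (hB : ContinuousPI1DK B)
    {u : ℝ → ℝ → Fin r → ℝ} (hu : Continuous fun z : ℝ × ℝ => u z.1 z.2) {s t x : ℝ}
    (hx : x ∈ Icc s t) (α β : ℝ) :
    PI1D s t A (fun η => ∫ ν in α..β, PI1D s t (B ν) (u ν) η) x =
      (∫ ν in α..β, (A.comp s t (B ν)).k0 x *ᵥ u ν x)
      + (∫ θ in s..x, ∫ ν in α..β, (A.comp s t (B ν)).k1 x θ *ᵥ u ν θ)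
      + ∫ θ in x..t, ∫ ν in α..β, (A.comp s t (B ν)).k2 x θ *ᵥ u ν θ := by
  have hC : ContinuousPI1DK fun ν => A.comp s t (B ν) :=
    (hA.comp_param (f := fun _ : ℝ => ()) (by fun_prop)).comp hB s t
  have h0 : Continuous fun ν => (A.comp s t (B ν)).k0 x *ᵥ u ν x :=
    (hC.continuous_k0 (by fun_prop) (by fun_prop)).matrix_mulVec (by fun_prop)
  have h1 : Continuous fun z : ℝ × ℝ => (A.comp s t (B z.1)).k1 x z.2 *ᵥ u z.1 z.2 :=
    (hC.continuous_k1 (by fun_prop) (by fun_prop) (by fun_prop)).matrix_mulVec (by fun_prop)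
  have h2 : Continuous fun z : ℝ × ℝ => (A.comp s t (B z.1)).k2 x z.2 *ᵥ u z.1 z.2 :=
    (hC.continuous_k2 (by fun_prop) (by fun_prop) (by fun_prop)).matrix_mulVec (by fun_prop)
  have c1 := continuous_intervalIntegral_of_continuous (s := fun _ => s) (t := fun _ => x)
    (f := fun ν θ => (A.comp s t (B ν)).k1 x θ *ᵥ u ν θ) h1 (by fun_prop) (by fun_prop)
  have c2 := continuous_intervalIntegral_of_continuous (s := fun _ => x) (t := fun _ => t)
    (f := fun ν θ => (A.comp s t (B ν)).k2 x θ *ᵥ u ν θ) h2 (by fun_prop) (by fun_prop)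
  rw [PI1D_integral hA (hB.continuous_PI1D hu s t),
    ← integral_integral_swap_of_continuous
      (f := fun ν θ => (A.comp s t (B ν)).k1 x θ *ᵥ u ν θ) h1,
    ← integral_integral_swap_of_continuous
      (f := fun ν θ => (A.comp s t (B ν)).k2 x θ *ᵥ u ν θ) h2,
    ← intervalIntegral.integral_add, ← intervalIntegral.integral_add]
  · refine intervalIntegral.integral_congr fun ν _ => ?_
    exact PI1D_comp hA (hB.comp_param (f := fun _ : Unit => ν) (by fun_prop)) (by fun_prop) hx
  all_goals exact Continuous.intervalIntegrable (by fun_prop) _ _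

section Rectangle

variable {G : Type*} [NormedAddCommGroup G] [NormedSpace ℝ G]

theorem integral_integral_add_of_continuous {f g : ℝ → ℝ → G}
    (hf : Continuous fun q : ℝ × ℝ => f q.1 q.2) (hg : Continuous fun q : ℝ × ℝ => g q.1 q.2)
    (s t α β : ℝ) :
    ∫ θ in s..t, ∫ ν in α..β, (f θ ν + g θ ν)
      = (∫ θ in s..t, ∫ ν in α..β, f θ ν) + ∫ θ in s..t, ∫ ν in α..β, g θ ν := by
  rw [← intervalIntegral.integral_add]
  · refine intervalIntegral.integral_congr fun θ _ => ?_
    exact intervalIntegral.integral_add (Continuous.intervalIntegrable (by fun_prop) _ _)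
      (Continuous.intervalIntegrable (by fun_prop) _ _)
  all_goals exact Continuous.intervalIntegrable (by fun_prop) _ _

theorem integral_integral_split_inner {f : ℝ → ℝ → G}
    (hf : Continuous fun q : ℝ × ℝ => f q.1 q.2) (s t c y d : ℝ) :
    ∫ θ in s..t, ∫ ν in c..d, f θ ν
      = (∫ θ in s..t, ∫ ν in c..y, f θ ν) + ∫ θ in s..t, ∫ ν in y..d, f θ ν := by
  rw [← intervalIntegral.integral_add]
  · refine intervalIntegral.integral_congr fun θ _ => ?_
    exact (intervalIntegral.integral_add_adjacent_intervals
      (Continuous.intervalIntegrable (by fun_prop) _ _)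
      (Continuous.intervalIntegrable (by fun_prop) _ _)).symm
  all_goals exact Continuous.intervalIntegrable (by fun_prop) _ _

theorem integral_integral_split_outer {f : ℝ → ℝ → G}
    (hf : Continuous fun q : ℝ × ℝ => f q.1 q.2) (a x b s t : ℝ) :
    ∫ θ in a..b, ∫ ν in s..t, f θ ν
      = (∫ θ in a..x, ∫ ν in s..t, f θ ν) + ∫ θ in x..b, ∫ ν in s..t, f θ ν :=
  (intervalIntegral.integral_add_adjacent_intervals
    (Continuous.intervalIntegrable (by fun_prop) _ _)
    (Continuous.intervalIntegrable (by fun_prop) _ _)).symm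

end Rectangle

theorem intervalIntegral_congr_Icc {G : Type*} [NormedAddCommGroup G] [NormedSpace ℝ G]
    {f g : ℝ → G} {a b s t : ℝ} (h : ∀ η ∈ Icc a b, f η = g η) (hs : s ∈ Icc a b)
    (ht : t ∈ Icc a b) : ∫ η in s..t, f η = ∫ η in s..t, g η :=
  intervalIntegral.integral_congr fun η hη => h η (uIcc_subset_Icc hs ht hη)

theorem PI1D_congr {p r : ℕ} {A B : PI1DK p r} {u v : ℝ → Fin r → ℝ} {s t x : ℝ}
    (hx : x ∈ Icc s t) (h0 : A.k0 x = B.k0 x) (h1 : ∀ θ ∈ Icc s t, A.k1 x θ = B.k1 x θ)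
    (h2 : ∀ θ ∈ Icc s t, A.k2 x θ = B.k2 x θ) (hu : ∀ θ ∈ Icc s t, u θ = v θ) :
    PI1D s t A u x = PI1D s t B v x := by
  have hst := hx.1.trans hx.2
  rw [PI1D, PI1D, h0, hu x hx,
    intervalIntegral_congr_Icc (fun θ hθ => by rw [h1 θ hθ, hu θ hθ]) (left_mem_Icc.2 hst) hx,
    intervalIntegral_congr_Icc (fun θ hθ => by rw [h2 θ hθ, hu θ hθ]) hx (right_mem_Icc.2 hst)]

theorem PI2D_congr {p r : ℕ} {a b c d : ℝ} (N : PI2DK p r) {u v : ℝ → ℝ → Fin r → ℝ}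
    (h : ∀ x ∈ Icc a b, ∀ y ∈ Icc c d, u x y = v x y) {x y : ℝ} (hx : x ∈ Icc a b)
    (hy : y ∈ Icc c d) : PI2D a b c d N u x y = PI2D a b c d N v x y := by
  have ha := left_mem_Icc.2 (hx.1.trans hx.2)
  have hb := right_mem_Icc.2 (hx.1.trans hx.2)
  have hc := left_mem_Icc.2 (hy.1.trans hy.2)
  have hd := right_mem_Icc.2 (hy.1.trans hy.2)
  unfold PI2D
  congr! 1
  · congr! 1
    · congr! 1
      · congr! 1
        · congr! 1
          · congr! 1
            · congr! 1
              · congr! 1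
                · rw [h x hx y hy]
                · exact intervalIntegral_congr_Icc (fun θ hθ => by rw [h θ hθ y hy]) ha hx
              · exact intervalIntegral_congr_Icc (fun θ hθ => by rw [h θ hθ y hy]) hx hb
            · exact intervalIntegral_congr_Icc (fun ν hν => by rw [h x hx ν hν]) hc hy
          · exact intervalIntegral_congr_Icc (fun ν hν => by rw [h x hx ν hν]) hy hd
        · exact intervalIntegral_congr_Icc (fun θ hθ =>
            intervalIntegral_congr_Icc (fun ν hν => by rw [h θ hθ ν hν]) hc hy) ha hx
      · exact intervalIntegral_congr_Icc (fun θ hθ =>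
          intervalIntegral_congr_Icc (fun ν hν => by rw [h θ hθ ν hν]) hc hy) hx hb
    · exact intervalIntegral_congr_Icc (fun θ hθ =>
        intervalIntegral_congr_Icc (fun ν hν => by rw [h θ hθ ν hν]) hy hd) ha hx
  · exact intervalIntegral_congr_Icc (fun θ hθ =>
      intervalIntegral_congr_Icc (fun ν hν => by rw [h θ hθ ν hν]) hy hd) hx hb

theorem exists_continuous_extension {Z : Type*} [TopologicalSpace Z] {f : ℝ → ℝ → Z}
    {a b c d : ℝ} (hab : a ≤ b) (hcd : c ≤ d)
    (hf : ContinuousOn (fun q : ℝ × ℝ => f q.1 q.2) (Icc a b ×ˢ Icc c d)) :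
    ∃ g : ℝ → ℝ → Z, (Continuous fun q : ℝ × ℝ => g q.1 q.2) ∧
      ∀ x ∈ Icc a b, ∀ y ∈ Icc c d, g x y = f x y := by
  refine ⟨fun x y => f (projIcc a b hab x) (projIcc c d hcd y), ?_, fun x hx y hy => ?_⟩
  · exact hf.comp_continuous
      (f := fun q : ℝ × ℝ => ((projIcc a b hab q.1 : ℝ), (projIcc c d hcd q.2 : ℝ)))
      (by fun_prop) fun q => ⟨Subtype.coe_prop _, Subtype.coe_prop _⟩
  · simp [projIcc_of_mem, hx, hy]

theorem exists_continuous_extension₃ {Z : Type*} [TopologicalSpace Z] {f : ℝ → ℝ → ℝ → Z}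
    {a b c d s t : ℝ} (hab : a ≤ b) (hcd : c ≤ d) (hst : s ≤ t)
    (hf : ContinuousOn (fun q : ℝ × ℝ × ℝ => f q.1 q.2.1 q.2.2)
      (Icc a b ×ˢ Icc c d ×ˢ Icc s t)) :
    ∃ g : ℝ → ℝ → ℝ → Z, (Continuous fun q : ℝ × ℝ × ℝ => g q.1 q.2.1 q.2.2) ∧
      ∀ x ∈ Icc a b, ∀ y ∈ Icc c d, ∀ θ ∈ Icc s t, g x y θ = f x y θ := by
  refine ⟨fun x y θ => f (projIcc a b hab x) (projIcc c d hcd y) (projIcc s t hst θ), ?_,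
    fun x hx y hy θ hθ => ?_⟩
  · exact hf.comp_continuous
      (f := fun q : ℝ × ℝ × ℝ => ((projIcc a b hab q.1 : ℝ), (projIcc c d hcd q.2.1 : ℝ),
        (projIcc s t hst q.2.2 : ℝ)))
      (by fun_prop) fun q => ⟨Subtype.coe_prop _, Subtype.coe_prop _, Subtype.coe_prop _⟩
  · simp [projIcc_of_mem, hx, hy, hθ]

/-- Kernels of the 2D-PI operator `u ↦ e * ∫∫ f u + P₁ u + P₂ u`, where `(P₁ u)(x, y)` is the
integral over `ν` of the 1D-PI operators with kernels `A (y, ν)` applied to `u(·, ν)` at `x`, and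
`(P₂ u)(x, y)` the integral over `θ` of those with kernels `B (x, θ)` applied to `u(θ, ·)` at `y`. -/
def PI2DK.ofLines {n p m : ℕ} (e : ℝ → ℝ → Matrix (Fin n) (Fin p) ℝ)
    (f : ℝ → ℝ → Matrix (Fin p) (Fin m) ℝ) (A B : ℝ × ℝ → PI1DK n m) : PI2DK n m where
  k00 _ _ := 0
  k10 x y θ := (B (x, θ)).k0 y
  k20 x y θ := (B (x, θ)).k0 y
  k01 x y ν := (A (y, ν)).k0 x
  k02 x y ν := (A (y, ν)).k0 x
  k11 x y θ ν := e x y * f θ ν + (A (y, ν)).k1 x θ + (B (x, θ)).k1 y ν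
  k21 x y θ ν := e x y * f θ ν + (A (y, ν)).k2 x θ + (B (x, θ)).k1 y ν
  k12 x y θ ν := e x y * f θ ν + (A (y, ν)).k1 x θ + (B (x, θ)).k2 y ν
  k22 x y θ ν := e x y * f θ ν + (A (y, ν)).k2 x θ + (B (x, θ)).k2 y ν

section OfLines

variable {n p m : ℕ} {e : ℝ → ℝ → Matrix (Fin n) (Fin p) ℝ}
  {f : ℝ → ℝ → Matrix (Fin p) (Fin m) ℝ} {A B : ℝ × ℝ → PI1DK n m}

theorem PI2DK.isCont_ofLines (he : Continuous fun q : ℝ × ℝ => e q.1 q.2)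
    (hf : Continuous fun q : ℝ × ℝ => f q.1 q.2) (hA : ContinuousPI1DK A)
    (hB : ContinuousPI1DK B) (a b c d : ℝ) : (PI2DK.ofLines e f A B).IsCont a b c d := by
  refine ⟨continuousOn_const, ?_, ?_, ?_, ?_, ?_, ?_, ?_, ?_⟩ <;> apply Continuous.continuousOn
  · exact hB.continuous_k0 (by fun_prop) (by fun_prop)
  · exact hB.continuous_k0 (by fun_prop) (by fun_prop)
  · exact hA.continuous_k0 (by fun_prop) (by fun_prop)
  · exact hA.continuous_k0 (by fun_prop) (by fun_prop)
  · exact (Continuous.add (by fun_prop)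
      (hA.continuous_k1 (by fun_prop) (by fun_prop) (by fun_prop))).add
      (hB.continuous_k1 (by fun_prop) (by fun_prop) (by fun_prop))
  · exact (Continuous.add (by fun_prop)
      (hA.continuous_k2 (by fun_prop) (by fun_prop) (by fun_prop))).add
      (hB.continuous_k1 (by fun_prop) (by fun_prop) (by fun_prop))
  · exact (Continuous.add (by fun_prop)
      (hA.continuous_k1 (by fun_prop) (by fun_prop) (by fun_prop))).add
      (hB.continuous_k2 (by fun_prop) (by fun_prop) (by fun_prop))
  · exact (Continuous.add (by fun_prop)
      (hA.continuous_k2 (by fun_prop) (by fun_prop) (by fun_prop))).add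
      (hB.continuous_k2 (by fun_prop) (by fun_prop) (by fun_prop))

theorem PI2D_ofLines (hf : Continuous fun q : ℝ × ℝ => f q.1 q.2) (hA : ContinuousPI1DK A)
    (hB : ContinuousPI1DK B) {u : ℝ → ℝ → Fin m → ℝ}
    (hu : Continuous fun q : ℝ × ℝ => u q.1 q.2) (a b c d x y : ℝ) :
    PI2D a b c d (PI2DK.ofLines e f A B) u x y =
      e x y *ᵥ (∫ θ in a..b, ∫ ν in c..d, f θ ν *ᵥ u θ ν)
      + ((∫ ν in c..d, (A (y, ν)).k0 x *ᵥ u x ν)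
        + (∫ θ in a..x, ∫ ν in c..d, (A (y, ν)).k1 x θ *ᵥ u θ ν)
        + ∫ θ in x..b, ∫ ν in c..d, (A (y, ν)).k2 x θ *ᵥ u θ ν)
      + ((∫ θ in a..b, (B (x, θ)).k0 y *ᵥ u θ y)
        + (∫ ν in c..y, ∫ θ in a..b, (B (x, θ)).k1 y ν *ᵥ u θ ν)
        + ∫ ν in y..d, ∫ θ in a..b, (B (x, θ)).k2 y ν *ᵥ u θ ν) := by
  have h0 : Continuous fun z : ℝ × ℝ => (e x y * f z.1 z.2) *ᵥ u z.1 z.2 := by fun_prop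
  have hA0 : Continuous fun ν => (A (y, ν)).k0 x *ᵥ u x ν :=
    (hA.continuous_k0 (by fun_prop) (by fun_prop)).matrix_mulVec (by fun_prop)
  have hB0 : Continuous fun θ => (B (x, θ)).k0 y *ᵥ u θ y :=
    (hB.continuous_k0 (by fun_prop) (by fun_prop)).matrix_mulVec (by fun_prop)
  have hA1 : Continuous fun z : ℝ × ℝ => (A (y, z.2)).k1 x z.1 *ᵥ u z.1 z.2 :=
    (hA.continuous_k1 (by fun_prop) (by fun_prop) (by fun_prop)).matrix_mulVec (by fun_prop)
  have hA2 : Continuous fun z : ℝ × ℝ => (A (y, z.2)).k2 x z.1 *ᵥ u z.1 z.2 :=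
    (hA.continuous_k2 (by fun_prop) (by fun_prop) (by fun_prop)).matrix_mulVec (by fun_prop)
  have hB1 : Continuous fun z : ℝ × ℝ => (B (x, z.1)).k1 y z.2 *ᵥ u z.1 z.2 :=
    (hB.continuous_k1 (by fun_prop) (by fun_prop) (by fun_prop)).matrix_mulVec (by fun_prop)
  have hB2 : Continuous fun z : ℝ × ℝ => (B (x, z.1)).k2 y z.2 *ᵥ u z.1 z.2 :=
    (hB.continuous_k2 (by fun_prop) (by fun_prop) (by fun_prop)).matrix_mulVec (by fun_prop)
  have add3 (F₁ F₂ F₃ : ℝ → ℝ → Fin n → ℝ) (h₁ : Continuous fun z : ℝ × ℝ => F₁ z.1 z.2)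
      (h₂ : Continuous fun z : ℝ × ℝ => F₂ z.1 z.2) (h₃ : Continuous fun z : ℝ × ℝ => F₃ z.1 z.2)
      (s t α β : ℝ) : ∫ θ in s..t, ∫ ν in α..β, (F₁ θ ν + F₂ θ ν + F₃ θ ν)
        = (∫ θ in s..t, ∫ ν in α..β, F₁ θ ν) + (∫ θ in s..t, ∫ ν in α..β, F₂ θ ν)
          + ∫ θ in s..t, ∫ ν in α..β, F₃ θ ν := by
    rw [integral_integral_add_of_continuous (f := fun θ ν => F₁ θ ν + F₂ θ ν) (h₁.add h₂) h₃,
      integral_integral_add_of_continuous h₁ h₂]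
  have pull : e x y *ᵥ (∫ θ in a..b, ∫ ν in c..d, f θ ν *ᵥ u θ ν)
      = ∫ θ in a..b, ∫ ν in c..d, (e x y * f θ ν) *ᵥ u θ ν := by
    rw [mulVec_intervalIntegral _ (by fun_prop)]
    refine intervalIntegral.integral_congr fun θ _ => ?_
    rw [mulVec_intervalIntegral _ (by fun_prop)]
    simp only [mulVec_mulVec]
  rw [pull,
    integral_integral_split_outer (f := fun θ ν => (e x y * f θ ν) *ᵥ u θ ν) h0 a x b,
    integral_integral_split_inner (f := fun θ ν => (e x y * f θ ν) *ᵥ u θ ν) h0 a x c y d,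
    integral_integral_split_inner (f := fun θ ν => (e x y * f θ ν) *ᵥ u θ ν) h0 x b c y d,
    integral_integral_split_inner (f := fun θ ν => (A (y, ν)).k1 x θ *ᵥ u θ ν) hA1 a x c y d,
    integral_integral_split_inner (f := fun θ ν => (A (y, ν)).k2 x θ *ᵥ u θ ν) hA2 x b c y d,
    ← integral_integral_swap_of_continuous
      (f := fun θ ν => (B (x, θ)).k1 y ν *ᵥ u θ ν) hB1,
    ← integral_integral_swap_of_continuous
      (f := fun θ ν => (B (x, θ)).k2 y ν *ᵥ u θ ν) hB2,
    integral_integral_split_outer (f := fun θ ν => (B (x, θ)).k1 y ν *ᵥ u θ ν) hB1 a x b,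
    integral_integral_split_outer (f := fun θ ν => (B (x, θ)).k2 y ν *ᵥ u θ ν) hB2 a x b,
    ← intervalIntegral.integral_add_adjacent_intervals (hA0.intervalIntegrable c y)
      (hA0.intervalIntegrable y d),
    ← intervalIntegral.integral_add_adjacent_intervals (hB0.intervalIntegrable a x)
      (hB0.intervalIntegrable x b)]
  simp only [PI2D, PI2DK.ofLines, add_mulVec, zero_mulVec]
  rw [add3 _ _ _ h0 hA1 hB1, add3 _ _ _ h0 hA2 hB1, add3 _ _ _ h0 hA1 hB2,
    add3 _ _ _ h0 hA2 hB2]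
  abel

end OfLines

/-- Composition of a (2D→011)-PI operator followed by a (011→2D)-PI
operator is a 2D-PI operator. -/
theorem composition_011to2D_after_2Dto011 {n2 p0 p1 m2 : ℕ} (a b c d : ℝ)
    (hab : a < b) (hcd : c < d)
    (E : PI011to2DK n2 p0 p1) (D : PI2Dto011K p0 p1 m2)
    (hE : E.IsCont a b c d) (hD : D.IsCont a b c d) :
    ∃ Q : PI2DK n2 m2, Q.IsCont a b c d ∧
      ∀ u : ℝ → ℝ → Fin m2 → ℝ,
        ContinuousOn (fun q : ℝ × ℝ => u q.1 q.2) (Icc a b ×ˢ Icc c d) →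
        ∀ x ∈ Icc a b, ∀ y ∈ Icc c d,
          PI011to2D a b c d E (PI2Dto011 a b c d D u).1
              (PI2Dto011 a b c d D u).2.1 (PI2Dto011 a b c d D u).2.2 x y
            = PI2D a b c d Q u x y := by
  obtain ⟨hE0, hE10, hE11, hE12, hE20, hE21, hE22⟩ := hE
  obtain ⟨hD0, hD10, hD11, hD12, hD20, hD21, hD22⟩ := hD
  obtain ⟨e0, ce0, he0⟩ := exists_continuous_extension hab.le hcd.le hE0
  obtain ⟨e10, ce10, he10⟩ := exists_continuous_extension hab.le hcd.le hE10
  obtain ⟨e11, ce11, he11⟩ := exists_continuous_extension₃ hab.le hcd.le hab.le hE11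
  obtain ⟨e12, ce12, he12⟩ := exists_continuous_extension₃ hab.le hcd.le hab.le hE12
  obtain ⟨e20, ce20, he20⟩ := exists_continuous_extension hab.le hcd.le hE20
  obtain ⟨e21, ce21, he21⟩ := exists_continuous_extension₃ hab.le hcd.le hcd.le hE21
  obtain ⟨e22, ce22, he22⟩ := exists_continuous_extension₃ hab.le hcd.le hcd.le hE22
  obtain ⟨d0, cd0, hd0⟩ := exists_continuous_extension hab.le hcd.le hD0
  obtain ⟨d10, cd10, hd10⟩ := exists_continuous_extension hab.le hcd.le hD10
  obtain ⟨d11, cd11, hd11⟩ := exists_continuous_extension₃ hab.le hcd.le hab.le hD11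
  obtain ⟨d12, cd12, hd12⟩ := exists_continuous_extension₃ hab.le hcd.le hab.le hD12
  obtain ⟨d20, cd20, hd20⟩ := exists_continuous_extension hab.le hcd.le hD20
  obtain ⟨d21, cd21, hd21⟩ := exists_continuous_extension₃ hab.le hcd.le hcd.le hD21
  obtain ⟨d22, cd22, hd22⟩ := exists_continuous_extension₃ hab.le hcd.le hcd.le hD22
  let Ex : ℝ → PI1DK n2 p1 := fun y => ⟨(e10 · y), (e11 · y ·), (e12 · y ·)⟩
  let Ey : ℝ → PI1DK n2 p1 := fun x => ⟨e20 x, e21 x, e22 x⟩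
  let Dx : ℝ → PI1DK p1 m2 := fun y => ⟨(d10 · y), (d11 · y ·), (d12 · y ·)⟩
  let Dy : ℝ → PI1DK p1 m2 := fun x => ⟨d20 x, d21 x, d22 x⟩
  have hEx : ContinuousPI1DK Ex := by constructor <;> dsimp only [Ex] <;> fun_prop
  have hEy : ContinuousPI1DK Ey := ⟨ce20, ce21, ce22⟩
  have hDx : ContinuousPI1DK Dx := by constructor <;> dsimp only [Dx] <;> fun_prop
  have hDy : ContinuousPI1DK Dy := ⟨cd20, cd21, cd22⟩
  have hCx : ContinuousPI1DK fun z : ℝ × ℝ => (Ex z.1).comp a b (Dx z.2) :=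
    (hEx.comp_param continuous_fst).comp (hDx.comp_param continuous_snd) a b
  have hCy : ContinuousPI1DK fun z : ℝ × ℝ => (Ey z.1).comp c d (Dy z.2) :=
    (hEy.comp_param continuous_fst).comp (hDy.comp_param continuous_snd) c d
  refine ⟨PI2DK.ofLines e0 d0 (fun z => (Ex z.1).comp a b (Dx z.2))
    (fun z => (Ey z.1).comp c d (Dy z.2)), PI2DK.isCont_ofLines ce0 cd0 hCx hCy a b c d,
    fun u hu x hx y hy => ?_⟩
  obtain ⟨v, cv, hv⟩ := exists_continuous_extension hab.le hcd.le hu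
  have ha := left_mem_Icc.2 hab.le
  have hb := right_mem_Icc.2 hab.le
  have hc := left_mem_Icc.2 hcd.le
  have hd := right_mem_Icc.2 hcd.le
  have w0 : (PI2Dto011 a b c d D u).1 = ∫ θ in a..b, ∫ ν in c..d, d0 θ ν *ᵥ v θ ν :=
    intervalIntegral_congr_Icc (fun θ hθ => intervalIntegral_congr_Icc
      (fun ν hν => by rw [hd0 θ hθ ν hν, hv θ hθ ν hν]) hc hd) ha hb
  have w1 : ∀ η ∈ Icc a b, (PI2Dto011 a b c d D u).2.1 η
      = ∫ ν in c..d, PI1D a b (Dx ν) (fun θ => v θ ν) η := fun η hη =>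
    intervalIntegral_congr_Icc (fun ν hν =>
      PI1D_congr (A := ⟨(D.d10 · ν), (D.d11 · ν ·), (D.d12 · ν ·)⟩) (u := (u · ν)) hη
        (hd10 η hη ν hν).symm (fun θ hθ => (hd11 η hη ν hν θ hθ).symm)
        (fun θ hθ => (hd12 η hη ν hν θ hθ).symm) fun θ hθ => (hv θ hθ ν hν).symm) hc hd
  have w2 : ∀ η ∈ Icc c d, (PI2Dto011 a b c d D u).2.2 η
      = ∫ θ in a..b, PI1D c d (Dy θ) (v θ) η := fun η hη =>
    intervalIntegral_congr_Icc (fun θ hθ =>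
      PI1D_congr (A := ⟨D.d20 θ, D.d21 θ, D.d22 θ⟩) (u := u θ) hη
        (hd20 θ hθ η hη).symm (fun ν hν => (hd21 θ hθ η hη ν hν).symm)
        (fun ν hν => (hd22 θ hθ η hη ν hν).symm) fun ν hν => (hv θ hθ ν hν).symm) ha hb
  have X : PI1D a b ⟨(E.e10 · y), (E.e11 · y ·), (E.e12 · y ·)⟩ (PI2Dto011 a b c d D u).2.1 x
      = PI1D a b (Ex y) (fun η => ∫ ν in c..d, PI1D a b (Dx ν) (fun θ => v θ ν) η) x :=
    PI1D_congr hx (he10 x hx y hy).symm (fun θ hθ => (he11 x hx y hy θ hθ).symm)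
      (fun θ hθ => (he12 x hx y hy θ hθ).symm) w1
  have Y : PI1D c d ⟨E.e20 x, E.e21 x, E.e22 x⟩ (PI2Dto011 a b c d D u).2.2 y
      = PI1D c d (Ey x) (fun η => ∫ θ in a..b, PI1D c d (Dy θ) (v θ) η) y :=
    PI1D_congr hy (he20 x hx y hy).symm (fun ν hν => (he21 x hx y hy ν hν).symm)
      (fun ν hν => (he22 x hx y hy ν hν).symm) w2
  rw [PI1D_comp_integral (u := fun ν θ => v θ ν)
    (hEx.comp_param (f := fun _ : Unit => y) continuous_const) hDx (by fun_prop) hx] at X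
  rw [PI1D_comp_integral (hEy.comp_param (f := fun _ : Unit => x) continuous_const) hDy cv hy] at Y
  rw [PI2D_congr _ (fun x hx y hy => (hv x hx y hy).symm) hx hy, PI2D_ofLines cd0 hCx hCy cv,
    ← X, ← Y, ← w0, he0 x hx y hy]
  simp only [PI011to2D, PI1D]
  abel
end
end

section
/- Consider 0112-PI operators: given a family B of 011-PI kernels of size (p0,p1)×(r0,r1), a family D of (2D→011)-PI kernels of size (p0,p1)×r2, a family E of (011→2D)-PI kernels of size p2×(r0,r1), and a family N of 2D-PI kernels of size p2×r2, the associated 0112-PI operator maps a quadruple (v, u1, u2, u), with v ∈ ℝ^{r0} and continuous u1 : [a,b] → ℝ^{r1}, u2 : [c,d] → ℝ^{r1}, u : [a,b]×[c,d] → ℝ^{r2}, to the quadruple whose first three components are the componentwise sum P[B](v,u1,u2) + P[D]u and whose fourth component is the function P[E](v,u1,u2) + P[N]u. Then 0112-PI operators are closed under composition: for any 0112-PI operator with kernels (B, D, E, N) of size (n0,n1,n2)×(p0,p1,p2) and any 0112-PI operator with kernels (B', D', E', N') of size (p0,p1,p2)×(m0,m1,m2), there exist kernels (B'', D'', E'',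 N'') of size (n0,n1,n2)×(m0,m1,m2) — B'' a family of 011-PI kernels, D'' a family of (2D→011)-PI kernels, E'' a family of (011→2D)-PI kernels, N'' a family of 2D-PI kernels — such that for every quadruple (v, u1, u2, u) as above, the composition of the two 0112-PI operators applied to (v, u1, u2, u) equals the 0112-PI operator with kernels (B'', D'', E'', N'') applied to (v, u1, u2, u). -/
open Matrix MeasureTheory Set

noncomputable section

/-- The 0112-PI operator associated with a quadruple of kernel families
`(B, D, E, N)`, acting on `ℝ^{r0} × L₂[x] × L₂[y] × L₂[x,y]`. -/
def PI0112 {p0 p1 p2 r0 r1 r2 : ℕ} (a b c d : ℝ)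
    (B : PI011K p0 p1 r0 r1) (D : PI2Dto011K p0 p1 r2)
    (E : PI011to2DK p2 r0 r1) (N : PI2DK p2 r2)
    (v : Fin r0 → ℝ) (u1 u2 : ℝ → Fin r1 → ℝ) (u : ℝ → ℝ → Fin r2 → ℝ) :
    (Fin p0 → ℝ) × (ℝ → Fin p1 → ℝ) × (ℝ → Fin p1 → ℝ) × (ℝ → ℝ → Fin p2 → ℝ) :=
  ( (PI011 a b c d B v u1 u2).1 + (PI2Dto011 a b c d D u).1,
    (PI011 a b c d B v u1 u2).2.1 + (PI2Dto011 a b c d D u).2.1,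
    (PI011 a b c d B v u1 u2).2.2 + (PI2Dto011 a b c d D u).2.2,
    fun x y => PI011to2D a b c d E v u1 u2 x y + PI2D a b c d N u x y )

set_option linter.unusedSectionVars false

section IntegralLemmas

variable {E : Type*} [NormedAddCommGroup E] [NormedSpace ℝ E]

@[fun_prop]
theorem Continuous.intervalIntegral_param {Z : Type*} [TopologicalSpace Z] {f : Z → ℝ → E}
    (hf : Continuous fun p : Z × ℝ => f p.1 p.2) {l r : Z → ℝ} (hl : Continuous l)
    (hr : Continuous r) : Continuous fun z => ∫ η in l z..r z, f z η := by
  have hfi : ∀ z s t, IntervalIntegrable (f z) volume s t := fun z s t =>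
    (hf.comp (Continuous.prodMk_right z)).intervalIntegrable s t
  have := (intervalIntegral.continuous_parametric_intervalIntegral_of_continuous
    (μ := volume) (a₀ := 0) hf hr).sub
    (intervalIntegral.continuous_parametric_intervalIntegral_of_continuous
    (μ := volume) (a₀ := 0) hf hl)
  exact this.congr fun z => intervalIntegral.integral_interval_sub_left (hfi z _ _) (hfi z _ _)

/-- Interchange of the order of integration over a triangle. -/
theorem integral_integral_lower_swap {f : ℝ → ℝ → E}
    (hf : Continuous fun p : ℝ × ℝ => f p.1 p.2) {s x : ℝ} (h : s ≤ x) :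
    ∫ η in s..x, ∫ θ in s..η, f η θ = ∫ θ in s..x, ∫ η in θ..x, f η θ := by
  have h1 : ∀ η ∈ Icc s x, ∫ θ in s..η, f η θ
      = ∫ θ in s..x, {p : ℝ × ℝ | p.2 ≤ p.1}.indicator (fun p => f p.1 p.2) (η, θ) := by
    intro η hη
    rw [← intervalIntegral.integral_indicator hη]
    rfl
  have h2 : ∀ θ ∈ Icc s x, ∫ η in θ..x, f η θ
      = ∫ η in s..x, {p : ℝ × ℝ | p.2 ≤ p.1}.indicator (fun p => f p.1 p.2) (η, θ) := by
    intro θ hθ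
    rw [intervalIntegral.integral_of_le hθ.2, intervalIntegral.integral_of_le h,
      ← integral_Icc_eq_integral_Ioc, ← integral_Icc_eq_integral_Ioc]
    have : (fun η => {p : ℝ × ℝ | p.2 ≤ p.1}.indicator (fun p => f p.1 p.2) (η, θ))
      = (Ici θ).indicator (fun η => f η θ) := rfl
    rw [this, setIntegral_indicator measurableSet_Ici]
    congr 2
    ext η
    simp only [mem_Icc, mem_inter_iff, mem_Ici]
    exact ⟨fun h => ⟨⟨hθ.1.trans h.1, h.2⟩, h.1⟩, fun h => ⟨h.2, h.1.2⟩⟩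
  rw [← uIcc_of_le h] at h1 h2
  rw [intervalIntegral.integral_congr h1, intervalIntegral.integral_congr h2]
  refine intervalIntegral_intervalIntegral_swap ?_
  have hc : IntegrableOn (fun p : ℝ × ℝ => f p.1 p.2) (uIcc s x ×ˢ uIcc s x) :=
    hf.continuousOn.integrableOn_compact (isCompact_uIcc.prod isCompact_uIcc)
  exact (hc.mono_set (prod_mono uIoc_subset_uIcc uIoc_subset_uIcc)).indicator
    (measurableSet_le measurable_snd measurable_fst)

/-- Interchange of the order of integration over a rectangle. -/
theorem integral_integral_rect_swap {f : ℝ → ℝ → E}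
    (hf : Continuous fun p : ℝ × ℝ => f p.1 p.2) (s x l r : ℝ) :
    ∫ η in s..x, ∫ θ in l..r, f η θ = ∫ θ in l..r, ∫ η in s..x, f η θ := by
  refine intervalIntegral_intervalIntegral_swap ?_
  have hc : IntegrableOn (fun p : ℝ × ℝ => f p.1 p.2) (uIcc s x ×ˢ uIcc l r) :=
    hf.continuousOn.integrableOn_compact (isCompact_uIcc.prod isCompact_uIcc)
  exact hc.mono_set (prod_mono uIoc_subset_uIcc uIoc_subset_uIcc)

theorem integral_integral_upper_swap {f : ℝ → ℝ → E}
    (hf : Continuous fun p : ℝ × ℝ => f p.1 p.2) {x t : ℝ} (h : x ≤ t) :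
    ∫ η in x..t, ∫ θ in η..t, f η θ = ∫ θ in x..t, ∫ η in x..θ, f η θ :=
  (integral_integral_lower_swap (f := fun η θ => f θ η)
    (hf.comp continuous_swap) h).symm

theorem Continuous.integral_add_adjacent {f : ℝ → E} (hf : Continuous f) (l m r : ℝ) :
    ∫ η in l..r, f η = (∫ η in l..m, f η) + ∫ η in m..r, f η :=
  (intervalIntegral.integral_add_adjacent_intervals (hf.intervalIntegrable _ _)
    (hf.intervalIntegrable _ _)).symm

theorem Continuous.integral_add {f g : ℝ → E} (hf : Continuous f) (hg : Continuous g) (l r : ℝ) :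
    ∫ η in l..r, (f η + g η) = (∫ η in l..r, f η) + ∫ η in l..r, g η :=
  intervalIntegral.integral_add (hf.intervalIntegrable _ _) (hg.intervalIntegrable _ _)

/-- Lower integration up to `x` of an upper integral. -/
theorem integral_lower_integral_upper {f : ℝ → ℝ → E}
    (hf : Continuous fun p : ℝ × ℝ => f p.1 p.2) {s x : ℝ} (t : ℝ) (h : s ≤ x) :
    ∫ η in s..x, ∫ θ in η..t, f η θ
      = (∫ θ in s..x, ∫ η in s..θ, f η θ) + ∫ θ in x..t, ∫ η in s..x, f η θ := by
  have h1 : ∀ η, ∫ θ in η..t, f η θ = (∫ θ in η..x, f η θ) + ∫ θ in x..t, f η θ := fun η =>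
    Continuous.integral_add_adjacent (by fun_prop) _ _ _
  simp_rw [h1]
  rw [Continuous.integral_add (by fun_prop) (by fun_prop), integral_integral_upper_swap hf h,
    integral_integral_rect_swap hf]

/-- Upper integration from `x` of a lower integral. -/
theorem integral_upper_integral_lower {f : ℝ → ℝ → E}
    (hf : Continuous fun p : ℝ × ℝ => f p.1 p.2) (s : ℝ) {x t : ℝ} (h : x ≤ t) :
    ∫ η in x..t, ∫ θ in s..η, f η θ
      = (∫ θ in s..x, ∫ η in x..t, f η θ) + ∫ θ in x..t, ∫ η in θ..t, f η θ := by
  have h1 : ∀ η, ∫ θ in s..η, f η θ = (∫ θ in s..x, f η θ) + ∫ θ in x..η, f η θ := fun η =>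
    Continuous.integral_add_adjacent (by fun_prop) _ _ _
  simp_rw [h1]
  rw [Continuous.integral_add (by fun_prop) (by fun_prop), integral_integral_lower_swap hf h,
    integral_integral_rect_swap hf]

end IntegralLemmas

/-- A system of spaces `V o` of vectors and spaces `H p q` of kernels, where a kernel in `H p q`
acts as a continuous additive map from `V q` to `V p`, and kernels can be composed. -/
structure KernelSystem {O : Type} (V : O → Type) (H : O → O → Type)
    [∀ o, NormedAddCommGroup (V o)] [∀ p q, NormedAddCommGroup (H p q)] where
  act : ∀ {p q : O}, H p q → V q → V p
  comp : ∀ {p q r : O}, H p q → H q r → H p r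
  add_act : ∀ {p q : O} (k l : H p q) (u : V q), act (k + l) u = act k u + act l u
  act_add : ∀ {p q : O} (k : H p q) (u v : V q), act k (u + v) = act k u + act k v
  continuous_act : ∀ {p q : O}, Continuous fun z : H p q × V q => act z.1 z.2
  continuous_comp : ∀ {p q r : O}, Continuous fun z : H p q × H q r => comp z.1 z.2
  act_comp : ∀ {p q r : O} (k : H p q) (l : H q r) (u : V r),
    act (comp k l) u = act k (act l u)

namespace KernelSystem

variable {O : Type} {V : O → Type} {H : O → O → Type}
    [∀ o, NormedAddCommGroup (V o)] [∀ p q, NormedAddCommGroup (H p q)]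

@[fun_prop]
theorem continuous_act_comp (S : KernelSystem V H) {Z : Type*} [TopologicalSpace Z] {p q : O}
    {f : Z → H p q} {g : Z → V q} (hf : Continuous f) (hg : Continuous g) :
    Continuous fun z => S.act (f z) (g z) :=
  S.continuous_act.comp (hf.prodMk hg)

@[fun_prop]
theorem continuous_comp_comp (S : KernelSystem V H) {Z : Type*} [TopologicalSpace Z] {p q r : O}
    {f : Z → H p q} {g : Z → H q r} (hf : Continuous f) (hg : Continuous g) :
    Continuous fun z => S.comp (f z) (g z) :=
  S.continuous_comp.comp (hf.prodMk hg)

variable [∀ o, NormedSpace ℝ (V o)] [∀ o, CompleteSpace (V o)]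
    [∀ p q, NormedSpace ℝ (H p q)] [∀ p q, CompleteSpace (H p q)]

theorem act_integral (S : KernelSystem V H) {p q : O} (k : H p q) {f : ℝ → V q}
    (hf : Continuous f) (l r : ℝ) :
    S.act k (∫ η in l..r, f η) = ∫ η in l..r, S.act k (f η) :=
  ((AddMonoidHom.toRealLinearMap (AddMonoidHom.mk' (S.act k) (S.act_add k))
    (by change Continuous fun u => S.act k u; fun_prop)).intervalIntegral_comp_comm
      (hf.intervalIntegrable l r)).symm

theorem integral_act (S : KernelSystem V H) {p q : O} {f : ℝ → H p q} (u : V q)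
    (hf : Continuous f) (l r : ℝ) :
    S.act (∫ η in l..r, f η) u = ∫ η in l..r, S.act (f η) u :=
  ((AddMonoidHom.toRealLinearMap (AddMonoidHom.mk' (fun k => S.act k u)
    (fun k l => S.add_act k l u))
    (by change Continuous fun k => S.act k u; fun_prop)).intervalIntegral_comp_comm
      (hf.intervalIntegrable l r)).symm

variable {s t : ℝ}

/-- Pairs of a vector and a continuous function of vectors on `[s,t]`. -/
abbrev PairSpace (V : O → Type) [∀ o, NormedAddCommGroup (V o)] (s t : ℝ) (o : O × O) : Type :=
  V o.1 × C(Icc s t, V o.2)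

/-- Kernels, on `[s,t]` and with values in `H`, of partial integral operators acting on pairs of a
vector and a continuous function. -/
abbrev PairKernel (H : O → O → Type) [∀ p q, NormedAddCommGroup (H p q)] (s t : ℝ)
    (p q : O × O) : Type :=
  H p.1 q.1 × C(Icc s t, H p.1 q.2) × C(Icc s t, H p.2 q.1) × C(Icc s t, H p.2 q.2) ×
    C(Icc s t × Icc s t, H p.2 q.2) × C(Icc s t × Icc s t, H p.2 q.2)

variable (S : KernelSystem V H) (h : s ≤ t)

@[fun_prop]
theorem _root_.Continuous.projIcc_comp {Z : Type*} [TopologicalSpace Z] {f : Z → ℝ}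
    (hf : Continuous f) : Continuous fun z => projIcc s t h (f z) :=
  continuous_projIcc.comp hf

/-- The partial integral operator with kernel `K`. -/
def pairAct {p q : O × O} (K : PairKernel H s t p q) (u : PairSpace V s t q) :
    PairSpace V s t p :=
  (S.act K.1 u.1 + ∫ θ in s..t, S.act (K.2.1 (projIcc s t h θ)) (u.2 (projIcc s t h θ)),
   ⟨fun x => S.act (K.2.2.1 x) u.1 + S.act (K.2.2.2.1 x) (u.2 x)
      + (∫ θ in s..x, S.act (K.2.2.2.2.1 (x, projIcc s t h θ)) (u.2 (projIcc s t h θ)))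
      + ∫ θ in x..t, S.act (K.2.2.2.2.2 (x, projIcc s t h θ)) (u.2 (projIcc s t h θ)),
    by fun_prop⟩)

/-- The kernel of the composition of two partial integral operators. -/
def pairComp {p q r : O × O} (K : PairKernel H s t p q) (L : PairKernel H s t q r) :
    PairKernel H s t p r :=
  let P := projIcc s t h
  (S.comp K.1 L.1 + ∫ η in s..t, S.comp (K.2.1 (P η)) (L.2.2.1 (P η)),
   ⟨fun θ => S.comp K.1 (L.2.1 θ) + S.comp (K.2.1 θ) (L.2.2.2.1 θ)
      + (∫ η in θ..t, S.comp (K.2.1 (P η)) (L.2.2.2.2.1 (P η, θ)))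
      + ∫ η in s..θ, S.comp (K.2.1 (P η)) (L.2.2.2.2.2 (P η, θ)), by fun_prop⟩,
   ⟨fun x => S.comp (K.2.2.1 x) L.1 + S.comp (K.2.2.2.1 x) (L.2.2.1 x)
      + (∫ η in s..x, S.comp (K.2.2.2.2.1 (x, P η)) (L.2.2.1 (P η)))
      + ∫ η in x..t, S.comp (K.2.2.2.2.2 (x, P η)) (L.2.2.1 (P η)), by fun_prop⟩,
   ⟨fun x => S.comp (K.2.2.2.1 x) (L.2.2.2.1 x), by fun_prop⟩,
   ⟨fun z => S.comp (K.2.2.1 z.1) (L.2.1 z.2) + S.comp (K.2.2.2.1 z.1) (L.2.2.2.2.1 z)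
      + S.comp (K.2.2.2.2.1 z) (L.2.2.2.1 z.2)
      + (∫ η in z.2..z.1, S.comp (K.2.2.2.2.1 (z.1, P η)) (L.2.2.2.2.1 (P η, z.2)))
      + (∫ η in s..z.2, S.comp (K.2.2.2.2.1 (z.1, P η)) (L.2.2.2.2.2 (P η, z.2)))
      + ∫ η in z.1..t, S.comp (K.2.2.2.2.2 (z.1, P η)) (L.2.2.2.2.1 (P η, z.2)),
    by fun_prop⟩,
   ⟨fun z => S.comp (K.2.2.1 z.1) (L.2.1 z.2) + S.comp (K.2.2.2.1 z.1) (L.2.2.2.2.2 z)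
      + S.comp (K.2.2.2.2.2 z) (L.2.2.2.1 z.2)
      + (∫ η in s..z.1, S.comp (K.2.2.2.2.1 (z.1, P η)) (L.2.2.2.2.2 (P η, z.2)))
      + (∫ η in z.2..t, S.comp (K.2.2.2.2.2 (z.1, P η)) (L.2.2.2.2.1 (P η, z.2)))
      + ∫ η in z.1..z.2, S.comp (K.2.2.2.2.2 (z.1, P η)) (L.2.2.2.2.2 (P η, z.2)),
    by fun_prop⟩)

theorem continuous_pairAct {p q : O × O} :
    Continuous fun z : PairKernel H s t p q × PairSpace V s t q => S.pairAct h z.1 z.2 := by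
  refine Continuous.prodMk (by fun_prop) (ContinuousMap.continuous_of_continuous_uncurry _ ?_)
  dsimp [Function.uncurry]
  fun_prop

theorem continuous_pairComp {p q r : O × O} :
    Continuous fun z : PairKernel H s t p q × PairKernel H s t q r => S.pairComp h z.1 z.2 := by
  refine Continuous.prodMk (by fun_prop) (Continuous.prodMk ?_ (Continuous.prodMk ?_
    (Continuous.prodMk ?_ (Continuous.prodMk ?_ ?_)))) <;>
  · refine ContinuousMap.continuous_of_continuous_uncurry _ ?_
    dsimp [Function.uncurry]
    fun_prop

theorem pairAct_add {p q : O × O} (K : PairKernel H s t p q) (u v : PairSpace V s t q) :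
    S.pairAct h K (u + v) = S.pairAct h K u + S.pairAct h K v := by
  refine Prod.ext ?_ (ContinuousMap.ext fun x => ?_)
  · simp only [pairAct, Prod.fst_add, Prod.snd_add, ContinuousMap.add_apply, S.act_add]
    rw [Continuous.integral_add (by fun_prop) (by fun_prop)]
    abel
  · simp only [pairAct, Prod.fst_add, Prod.snd_add, ContinuousMap.add_apply, S.act_add,
      ContinuousMap.coe_mk]
    rw [Continuous.integral_add (by fun_prop) (by fun_prop),
      Continuous.integral_add (by fun_prop) (by fun_prop)]
    abel

theorem add_pairAct {p q : O × O} (K L : PairKernel H s t p q) (u : PairSpace V s t q) :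
    S.pairAct h (K + L) u = S.pairAct h K u + S.pairAct h L u := by
  refine Prod.ext ?_ (ContinuousMap.ext fun x => ?_)
  · simp only [pairAct, Prod.fst_add, Prod.snd_add, ContinuousMap.add_apply, S.add_act]
    rw [Continuous.integral_add (by fun_prop) (by fun_prop)]
    abel
  · simp only [pairAct, Prod.fst_add, Prod.snd_add, ContinuousMap.add_apply, S.add_act,
      ContinuousMap.coe_mk]
    rw [Continuous.integral_add (by fun_prop) (by fun_prop),
      Continuous.integral_add (by fun_prop) (by fun_prop)]
    abel

theorem _root_.integral_congr_of_mem_Icc {E : Type*} [NormedAddCommGroup E] [NormedSpace ℝ E]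
    {f g : ℝ → E} {s t l r : ℝ} (hl : l ∈ Icc s t) (hr : r ∈ Icc s t)
    (hfg : ∀ θ ∈ Icc s t, f θ = g θ) : ∫ θ in l..r, f θ = ∫ θ in l..r, g θ :=
  intervalIntegral.integral_congr fun θ hθ => hfg θ (uIcc_subset_Icc hl hr hθ)

theorem _root_.integral_integral_to_projIcc {E : Type*} [NormedAddCommGroup E] [NormedSpace ℝ E]
    {s t l r : ℝ} (h : s ≤ t) (hl : l ∈ Icc s t) (hr : r ∈ Icc s t) (F : ℝ → ℝ → E) (m : ℝ) :
    ∫ θ in l..r, ∫ η in m..(projIcc s t h θ), F θ η = ∫ θ in l..r, ∫ η in m..θ, F θ η :=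
  integral_congr_of_mem_Icc hl hr fun θ hθ => by rw [projIcc_of_mem h hθ]

theorem _root_.integral_integral_from_projIcc {E : Type*} [NormedAddCommGroup E] [NormedSpace ℝ E]
    {s t l r : ℝ} (h : s ≤ t) (hl : l ∈ Icc s t) (hr : r ∈ Icc s t) (F : ℝ → ℝ → E) (m : ℝ) :
    ∫ θ in l..r, ∫ η in (projIcc s t h θ)..m, F θ η = ∫ θ in l..r, ∫ η in θ..m, F θ η :=
  integral_congr_of_mem_Icc hl hr fun θ hθ => by rw [projIcc_of_mem h hθ]

theorem pairAct_pairComp {p q r : O × O} (K : PairKernel H s t p q) (L : PairKernel H s t q r)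
    (u : PairSpace V s t r) :
    S.pairAct h (S.pairComp h K L) u = S.pairAct h K (S.pairAct h L u) := by
  have hs : s ∈ Icc s t := left_mem_Icc.2 h
  have ht : t ∈ Icc s t := right_mem_Icc.2 h
  obtain ⟨k, k01, k10, k0, k1, k2⟩ := K
  obtain ⟨l, l01, l10, l0, l1, l2⟩ := L
  obtain ⟨v, w⟩ := u
  refine Prod.ext ?_ (ContinuousMap.ext fun x => ?_)
  · simp only [pairAct, pairComp, ContinuousMap.coe_mk]
    simp (disch := fun_prop) only [S.add_act, S.act_add, S.integral_act, S.act_integral,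
      S.act_comp, Continuous.integral_add]
    simp only [integral_integral_to_projIcc, integral_integral_from_projIcc, hs, ht]
    rw [integral_integral_lower_swap (f := fun η θ => S.act (k01 (projIcc s t h η))
        (S.act (l1 (projIcc s t h η, projIcc s t h θ)) (w (projIcc s t h θ)))) (by fun_prop) h,
      integral_integral_upper_swap (f := fun η θ => S.act (k01 (projIcc s t h η))
        (S.act (l2 (projIcc s t h η, projIcc s t h θ)) (w (projIcc s t h θ)))) (by fun_prop) h]
    abel
  · have hsx : s ≤ x := x.2.1
    have hxt : x ≤ t := x.2.2
    have hx : (x : ℝ) ∈ Icc s t := x.2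
    simp only [pairAct, pairComp, ContinuousMap.coe_mk]
    simp (disch := fun_prop) only [S.add_act, S.act_add, S.integral_act, S.act_integral,
      S.act_comp, Continuous.integral_add]
    simp only [integral_integral_to_projIcc, integral_integral_from_projIcc, hs, ht, hx]
    rw [integral_integral_lower_swap (f := fun η θ => S.act (k1 (x, projIcc s t h η))
        (S.act (l1 (projIcc s t h η, projIcc s t h θ)) (w (projIcc s t h θ)))) (by fun_prop) hsx,
      integral_lower_integral_upper (f := fun η θ => S.act (k1 (x, projIcc s t h η))
        (S.act (l2 (projIcc s t h η, projIcc s t h θ)) (w (projIcc s t h θ)))) (by fun_prop) t hsx,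
      integral_upper_integral_lower (f := fun η θ => S.act (k2 (x, projIcc s t h η))
        (S.act (l1 (projIcc s t h η, projIcc s t h θ)) (w (projIcc s t h θ)))) (by fun_prop) s hxt,
      integral_integral_upper_swap (f := fun η θ => S.act (k2 (x, projIcc s t h η))
        (S.act (l2 (projIcc s t h η, projIcc s t h θ)) (w (projIcc s t h θ)))) (by fun_prop) hxt,
      Continuous.integral_add_adjacent (f := fun η => S.act (k10 x)
        (S.act (l01 (projIcc s t h η)) (w (projIcc s t h η)))) (by fun_prop) s x t]
    abel

/-- The system of partial integral operators on `[s,t]` over a given kernel system. -/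
def pair : KernelSystem (PairSpace V s t) (PairKernel H s t) where
  act := S.pairAct h
  comp := S.pairComp h
  add_act := S.add_pairAct h
  act_add := S.pairAct_add h
  continuous_act := S.continuous_pairAct h
  continuous_comp := S.continuous_pairComp h
  act_comp := S.pairAct_pairComp h

/-- The kernel system of continuous linear maps between the spaces `ℝⁿ`. -/
def base : KernelSystem (fun n : ℕ => Fin n → ℝ)
    (fun p q : ℕ => (Fin q → ℝ) →L[ℝ] (Fin p → ℝ)) where
  act k u := k u
  comp k l := k.comp l
  add_act _ _ _ := rfl
  act_add k u v := k.map_add u v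
  continuous_act := by fun_prop
  continuous_comp := by fun_prop
  act_comp _ _ _ := rfl

/-- The kernel system of which the 0112-PI operators are the action. -/
def rect {a b c d : ℝ} (hab : a ≤ b) (hcd : c ≤ d) :
    KernelSystem (PairSpace (PairSpace (fun n : ℕ => Fin n → ℝ) c d) a b)
      (PairKernel (PairKernel (fun p q : ℕ => (Fin q → ℝ) →L[ℝ] (Fin p → ℝ)) c d) a b) :=
  haveI : ∀ p q : ℕ × ℕ, CompleteSpace
      (PairKernel (fun p q : ℕ => (Fin q → ℝ) →L[ℝ] (Fin p → ℝ)) c d p q) := fun p q => by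
    have (p q : ℕ) : CompleteSpace ((Fin q → ℝ) →L[ℝ] (Fin p → ℝ)) := inferInstance
    infer_instance
  (base.pair hcd).pair hab

section IteratedPair

theorem _root_.fst_intervalIntegral {E F : Type*} [NormedAddCommGroup E] [NormedSpace ℝ E]
    [CompleteSpace E] [NormedAddCommGroup F] [NormedSpace ℝ F] [CompleteSpace F]
    {f : ℝ → E × F} (hf : Continuous f) (l r : ℝ) :
    (∫ η in l..r, f η).1 = ∫ η in l..r, (f η).1 :=
  ((ContinuousLinearMap.fst ℝ E F).intervalIntegral_comp_comm (hf.intervalIntegrable l r)).symm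

theorem _root_.snd_intervalIntegral_apply {X E F : Type*} [TopologicalSpace X] [CompactSpace X]
    [NormedAddCommGroup E] [NormedSpace ℝ E]
    [CompleteSpace E] [NormedAddCommGroup F] [NormedSpace ℝ F] [CompleteSpace F]
    {f : ℝ → E × C(X, F)} (hf : Continuous f) (l r : ℝ) (x : X) :
    (∫ η in l..r, f η).2 x = ∫ η in l..r, (f η).2 x :=
  (((ContinuousMap.evalCLM ℝ x).comp
    (ContinuousLinearMap.snd ℝ E C(X, F))).intervalIntegral_comp_comm
      (hf.intervalIntegrable l r)).symm

variable {a b c d : ℝ} (hab : a ≤ b) (hcd : c ≤ d) {p q : (O × O) × (O × O)}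
  (K : PairKernel (PairKernel H c d) a b p q) (U : PairSpace (PairSpace V c d) a b q)

theorem pair_pairAct_fst_fst :
    ((S.pair hcd).pairAct hab K U).1.1
      = (S.act K.1.1 U.1.1
        + (∫ θ in a..b, S.act (K.2.1 (projIcc a b hab θ)).1 (U.2 (projIcc a b hab θ)).1)
        + (∫ ν in c..d, S.act (K.1.2.1 (projIcc c d hcd ν)) (U.1.2 (projIcc c d hcd ν))))
        + ∫ θ in a..b, ∫ ν in c..d,
          S.act ((K.2.1 (projIcc a b hab θ)).2.1 (projIcc c d hcd ν))
            ((U.2 (projIcc a b hab θ)).2 (projIcc c d hcd ν)) := by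
  simp (disch := fun_prop) only [pairAct, Prod.fst_add, fst_intervalIntegral]
  simp only [pair, pairAct]
  rw [Continuous.integral_add (by fun_prop) (by fun_prop)]
  abel

theorem pair_pairAct_snd_fst (x : Icc a b) :
    (((S.pair hcd).pairAct hab K U).2 x).1
      = (S.act (K.2.2.1 x).1 U.1.1
        + (S.act (K.2.2.2.1 x).1 (U.2 x).1
          + (∫ θ in a..x, S.act (K.2.2.2.2.1 (x, projIcc a b hab θ)).1
              (U.2 (projIcc a b hab θ)).1)
          + (∫ θ in x..b, S.act (K.2.2.2.2.2 (x, projIcc a b hab θ)).1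
              (U.2 (projIcc a b hab θ)).1))
        + (∫ ν in c..d, S.act ((K.2.2.1 x).2.1 (projIcc c d hcd ν)) (U.1.2 (projIcc c d hcd ν))))
        + ∫ y in c..d, (S.act ((K.2.2.2.1 x).2.1 (projIcc c d hcd y))
              ((U.2 x).2 (projIcc c d hcd y))
          + (∫ θ in a..x, S.act
              ((K.2.2.2.2.1 (x, projIcc a b hab θ)).2.1 (projIcc c d hcd y))
              ((U.2 (projIcc a b hab θ)).2 (projIcc c d hcd y)))
          + (∫ θ in x..b, S.act
              ((K.2.2.2.2.2 (x, projIcc a b hab θ)).2.1 (projIcc c d hcd y))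
              ((U.2 (projIcc a b hab θ)).2 (projIcc c d hcd y)))) := by
  simp (disch := fun_prop) only [pairAct, Prod.fst_add, fst_intervalIntegral, ContinuousMap.coe_mk]
  simp only [pair, pairAct]
  simp (disch := fun_prop) only [Continuous.integral_add]
  rw [integral_integral_rect_swap (f := fun θ y => S.act
      ((K.2.2.2.2.1 (x, projIcc a b hab θ)).2.1 (projIcc c d hcd y))
      ((U.2 (projIcc a b hab θ)).2 (projIcc c d hcd y))) (by fun_prop),
    integral_integral_rect_swap (f := fun θ y => S.act
      ((K.2.2.2.2.2 (x, projIcc a b hab θ)).2.1 (projIcc c d hcd y))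
      ((U.2 (projIcc a b hab θ)).2 (projIcc c d hcd y))) (by fun_prop)]
  abel

theorem pair_pairAct_fst_snd (y : Icc c d) :
    ((S.pair hcd).pairAct hab K U).1.2 y
      = (S.act (K.1.2.2.1 y) U.1.1
        + (∫ θ in a..b, S.act ((K.2.1 (projIcc a b hab θ)).2.2.1 y)
            (U.2 (projIcc a b hab θ)).1)
        + (S.act (K.1.2.2.2.1 y) (U.1.2 y)
          + (∫ ν in c..y, S.act (K.1.2.2.2.2.1 (y, projIcc c d hcd ν))
              (U.1.2 (projIcc c d hcd ν)))
          + (∫ ν in y..d, S.act (K.1.2.2.2.2.2 (y, projIcc c d hcd ν))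
              (U.1.2 (projIcc c d hcd ν)))))
        + ∫ x in a..b, (S.act ((K.2.1 (projIcc a b hab x)).2.2.2.1 y)
              ((U.2 (projIcc a b hab x)).2 y)
          + (∫ ν in c..y, S.act
              ((K.2.1 (projIcc a b hab x)).2.2.2.2.1 (y, projIcc c d hcd ν))
              ((U.2 (projIcc a b hab x)).2 (projIcc c d hcd ν)))
          + (∫ ν in y..d, S.act
              ((K.2.1 (projIcc a b hab x)).2.2.2.2.2 (y, projIcc c d hcd ν))
              ((U.2 (projIcc a b hab x)).2 (projIcc c d hcd ν)))) := by
  simp (disch := fun_prop) only [pairAct, Prod.snd_add, snd_intervalIntegral_apply,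
    ContinuousMap.add_apply]
  simp only [pair, pairAct, ContinuousMap.coe_mk]
  simp (disch := fun_prop) only [Continuous.integral_add]
  abel

theorem pair_pairAct_snd_snd (x : Icc a b) (y : Icc c d) :
    (((S.pair hcd).pairAct hab K U).2 x).2 y
      = (S.act ((K.2.2.1 x).2.2.1 y) U.1.1
        + S.act ((K.2.2.2.1 x).2.2.1 y) (U.2 x).1
        + (∫ θ in a..x, S.act ((K.2.2.2.2.1 (x, projIcc a b hab θ)).2.2.1 y)
            (U.2 (projIcc a b hab θ)).1)
        + (∫ θ in x..b, S.act ((K.2.2.2.2.2 (x, projIcc a b hab θ)).2.2.1 y)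
            (U.2 (projIcc a b hab θ)).1)
        + S.act ((K.2.2.1 x).2.2.2.1 y) (U.1.2 y)
        + (∫ ν in c..y, S.act ((K.2.2.1 x).2.2.2.2.1 (y, projIcc c d hcd ν))
            (U.1.2 (projIcc c d hcd ν)))
        + (∫ ν in y..d, S.act ((K.2.2.1 x).2.2.2.2.2 (y, projIcc c d hcd ν))
            (U.1.2 (projIcc c d hcd ν))))
        + (S.act ((K.2.2.2.1 x).2.2.2.1 y) ((U.2 x).2 y)
        + (∫ θ in a..x, S.act ((K.2.2.2.2.1 (x, projIcc a b hab θ)).2.2.2.1 y)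
            ((U.2 (projIcc a b hab θ)).2 y))
        + (∫ θ in x..b, S.act ((K.2.2.2.2.2 (x, projIcc a b hab θ)).2.2.2.1 y)
            ((U.2 (projIcc a b hab θ)).2 y))
        + (∫ ν in c..y, S.act ((K.2.2.2.1 x).2.2.2.2.1 (y, projIcc c d hcd ν))
            ((U.2 x).2 (projIcc c d hcd ν)))
        + (∫ ν in y..d, S.act ((K.2.2.2.1 x).2.2.2.2.2 (y, projIcc c d hcd ν))
            ((U.2 x).2 (projIcc c d hcd ν)))
        + (∫ θ in a..x, ∫ ν in c..y,
            S.act ((K.2.2.2.2.1 (x, projIcc a b hab θ)).2.2.2.2.1 (y, projIcc c d hcd ν))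
              ((U.2 (projIcc a b hab θ)).2 (projIcc c d hcd ν)))
        + (∫ θ in x..b, ∫ ν in c..y,
            S.act ((K.2.2.2.2.2 (x, projIcc a b hab θ)).2.2.2.2.1 (y, projIcc c d hcd ν))
              ((U.2 (projIcc a b hab θ)).2 (projIcc c d hcd ν)))
        + (∫ θ in a..x, ∫ ν in y..d,
            S.act ((K.2.2.2.2.1 (x, projIcc a b hab θ)).2.2.2.2.2 (y, projIcc c d hcd ν))
              ((U.2 (projIcc a b hab θ)).2 (projIcc c d hcd ν)))
        + (∫ θ in x..b, ∫ ν in y..d,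
            S.act ((K.2.2.2.2.2 (x, projIcc a b hab θ)).2.2.2.2.2 (y, projIcc c d hcd ν))
              ((U.2 (projIcc a b hab θ)).2 (projIcc c d hcd ν)))) := by
  simp (disch := fun_prop) only [pairAct, Prod.snd_add, snd_intervalIntegral_apply,
    ContinuousMap.add_apply, ContinuousMap.coe_mk]
  simp only [pair, pairAct, ContinuousMap.coe_mk]
  simp (disch := fun_prop) only [Continuous.integral_add]
  abel

end IteratedPair

end KernelSystem

section MatrixKernels

/-- Multiplication by a matrix as a continuous linear map. -/
def mulVecCLM {p r : ℕ} (M : Matrix (Fin p) (Fin r) ℝ) : (Fin r → ℝ) →L[ℝ] (Fin p → ℝ) :=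
  LinearMap.toContinuousLinearMap (Matrix.toLin' M)

/-- The matrix of a continuous linear map. -/
def toMat {p r : ℕ} (k : (Fin r → ℝ) →L[ℝ] (Fin p → ℝ)) : Matrix (Fin p) (Fin r) ℝ :=
  LinearMap.toMatrix' (k : (Fin r → ℝ) →ₗ[ℝ] (Fin p → ℝ))

theorem mulVecCLM_apply {p r : ℕ} (M : Matrix (Fin p) (Fin r) ℝ) (u : Fin r → ℝ) :
    mulVecCLM M u = M *ᵥ u := by
  simp [mulVecCLM]

theorem mulVecCLM_toMat {p r : ℕ} (k : (Fin r → ℝ) →L[ℝ] (Fin p → ℝ)) :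
    mulVecCLM (toMat k) = k := by
  ext1 u
  simp [mulVecCLM, toMat]

theorem continuous_mulVecCLM {p r : ℕ} : Continuous (mulVecCLM (p := p) (r := r)) :=
  (LinearMap.toContinuousLinearMap.toLinearMap ∘ₗ
    (Matrix.toLin' (R := ℝ) (n := Fin r) (m := Fin p)).toLinearMap).continuous_of_finiteDimensional

theorem continuous_toMat {p r : ℕ} : Continuous (toMat (p := p) (r := r)) :=
  continuous_matrix fun i j => by
    simp only [toMat, LinearMap.toMatrix'_apply]
    change Continuous fun k : (Fin r → ℝ) →L[ℝ] (Fin p → ℝ) => k _ i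
    fun_prop

@[fun_prop]
theorem Continuous.toMat_comp {Z : Type*} [TopologicalSpace Z] {p r : ℕ}
    {f : Z → (Fin r → ℝ) →L[ℝ] (Fin p → ℝ)} (hf : Continuous f) :
    Continuous fun z => toMat (f z) :=
  continuous_toMat.comp hf

/-- The bundled kernel `z ↦ k (f z)` for a matrix kernel `k` that is continuous on `s`. -/
def ofKer {X Z : Type*} [TopologicalSpace X] [TopologicalSpace Z] {p r : ℕ}
    {k : X → Matrix (Fin p) (Fin r) ℝ} {s : Set X} (hk : ContinuousOn k s) (f : Z → X)
    (hf : Continuous f := by fun_prop) 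
    (hs : ∀ z, f z ∈ s := by intro z; simp only [mem_prod, Subtype.coe_prop, and_self]) :
    C(Z, (Fin r → ℝ) →L[ℝ] (Fin p → ℝ)) :=
  ⟨fun z => mulVecCLM (k (f z)), continuous_mulVecCLM.comp (hk.comp_continuous hf hs)⟩

end MatrixKernels

section Unbundled

/-- Bundled continuous quadruples on `[a,b] × [c,d]`. -/
abbrev RectSpace (a b c d : ℝ) : (ℕ × ℕ) × (ℕ × ℕ) → Type :=
  KernelSystem.PairSpace (KernelSystem.PairSpace (fun n : ℕ => Fin n → ℝ) c d) a b

/-- Bundled kernels of 0112-PI operators on `[a,b] × [c,d]`. -/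
abbrev RectKernel (a b c d : ℝ) : (ℕ × ℕ) × (ℕ × ℕ) → (ℕ × ℕ) × (ℕ × ℕ) → Type :=
  KernelSystem.PairKernel
    (KernelSystem.PairKernel (fun p q : ℕ => (Fin q → ℝ) →L[ℝ] (Fin p → ℝ)) c d) a b

/-- A continuous family of pair kernels, given by its components. -/
def pairKernelMap {Z : Type} [TopologicalSpace Z] {c d : ℝ} {p q : ℕ × ℕ}
    (k : C(Z, (Fin q.1 → ℝ) →L[ℝ] (Fin p.1 → ℝ)))
    (k01 : C(Z × Icc c d, (Fin q.2 → ℝ) →L[ℝ] (Fin p.1 → ℝ)))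
    (k10 : C(Z × Icc c d, (Fin q.1 → ℝ) →L[ℝ] (Fin p.2 → ℝ)))
    (k0 : C(Z × Icc c d, (Fin q.2 → ℝ) →L[ℝ] (Fin p.2 → ℝ)))
    (k1 k2 : C(Z × (Icc c d × Icc c d), (Fin q.2 → ℝ) →L[ℝ] (Fin p.2 → ℝ))) :
    C(Z, KernelSystem.PairKernel (fun p q : ℕ => (Fin q → ℝ) →L[ℝ] (Fin p → ℝ)) c d p q) :=
  k.prodMk (k01.curry.prodMk (k10.curry.prodMk (k0.curry.prodMk (k1.curry.prodMk k2.curry))))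

variable {a b c d : ℝ}

/-- The bundled quadruple `U` represents `(v, u1, u2, u)`. -/
structure VecRep {m0 m1 m2 : ℕ} (v : Fin m0 → ℝ) (u1 u2 : ℝ → Fin m1 → ℝ)
    (u : ℝ → ℝ → Fin m2 → ℝ) (U : RectSpace a b c d ((m0, m1), (m1, m2))) : Prop where
  fst_fst : U.1.1 = v
  snd_fst : ∀ x, (U.2 x).1 = u1 x
  fst_snd : ∀ y, U.1.2 y = u2 y
  snd_snd : ∀ x y, (U.2 x).2 y = u x y

/-- The bundled kernel `K` represents `(B, D, E, N)`. -/
structure KerRep {n0 n1 n2 m0 m1 m2 : ℕ} (B : PI011K n0 n1 m0 m1) (D : PI2Dto011K n0 n1 m2)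
    (E : PI011to2DK n2 m0 m1) (N : PI2DK n2 m2)
    (K : RectKernel a b c d ((n0, n1), (n1, n2)) ((m0, m1), (m1, m2))) : Prop where
  b00 : K.1.1 = mulVecCLM B.b00
  b02 : ∀ y, K.1.2.1 y = mulVecCLM (B.b02 y)
  b20 : ∀ y, K.1.2.2.1 y = mulVecCLM (B.b20 y)
  b22_k0 : ∀ y, K.1.2.2.2.1 y = mulVecCLM (B.b22.k0 y)
  b22_k1 : ∀ y ν, K.1.2.2.2.2.1 (y, ν) = mulVecCLM (B.b22.k1 y ν)
  b22_k2 : ∀ y ν, K.1.2.2.2.2.2 (y, ν) = mulVecCLM (B.b22.k2 y ν)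
  b01 : ∀ x, (K.2.1 x).1 = mulVecCLM (B.b01 x)
  d0 : ∀ x y, (K.2.1 x).2.1 y = mulVecCLM (D.d0 x y)
  b21 : ∀ y x, (K.2.1 x).2.2.1 y = mulVecCLM (B.b21 y x)
  d20 : ∀ x y, (K.2.1 x).2.2.2.1 y = mulVecCLM (D.d20 x y)
  d21 : ∀ x y ν, (K.2.1 x).2.2.2.2.1 (y, ν) = mulVecCLM (D.d21 x y ν)
  d22 : ∀ x y ν, (K.2.1 x).2.2.2.2.2 (y, ν) = mulVecCLM (D.d22 x y ν)
  b10 : ∀ x, (K.2.2.1 x).1 = mulVecCLM (B.b10 x)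
  b12 : ∀ x y, (K.2.2.1 x).2.1 y = mulVecCLM (B.b12 x y)
  e0 : ∀ x y, (K.2.2.1 x).2.2.1 y = mulVecCLM (E.e0 x y)
  e20 : ∀ x y, (K.2.2.1 x).2.2.2.1 y = mulVecCLM (E.e20 x y)
  e21 : ∀ x y ν, (K.2.2.1 x).2.2.2.2.1 (y, ν) = mulVecCLM (E.e21 x y ν)
  e22 : ∀ x y ν, (K.2.2.1 x).2.2.2.2.2 (y, ν) = mulVecCLM (E.e22 x y ν)
  b11_k0 : ∀ x, (K.2.2.2.1 x).1 = mulVecCLM (B.b11.k0 x)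
  d10 : ∀ x y, (K.2.2.2.1 x).2.1 y = mulVecCLM (D.d10 x y)
  e10 : ∀ x y, (K.2.2.2.1 x).2.2.1 y = mulVecCLM (E.e10 x y)
  k00 : ∀ x y, (K.2.2.2.1 x).2.2.2.1 y = mulVecCLM (N.k00 x y)
  k01 : ∀ x y ν, (K.2.2.2.1 x).2.2.2.2.1 (y, ν) = mulVecCLM (N.k01 x y ν)
  k02 : ∀ x y ν, (K.2.2.2.1 x).2.2.2.2.2 (y, ν) = mulVecCLM (N.k02 x y ν)
  b11_k1 : ∀ x θ, (K.2.2.2.2.1 (x, θ)).1 = mulVecCLM (B.b11.k1 x θ)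
  d11 : ∀ x y θ, (K.2.2.2.2.1 (x, θ)).2.1 y = mulVecCLM (D.d11 x y θ)
  e11 : ∀ x y θ, (K.2.2.2.2.1 (x, θ)).2.2.1 y = mulVecCLM (E.e11 x y θ)
  k10 : ∀ x y θ, (K.2.2.2.2.1 (x, θ)).2.2.2.1 y = mulVecCLM (N.k10 x y θ)
  k11 : ∀ x y θ ν, (K.2.2.2.2.1 (x, θ)).2.2.2.2.1 (y, ν) = mulVecCLM (N.k11 x y θ ν)
  k12 : ∀ x y θ ν, (K.2.2.2.2.1 (x, θ)).2.2.2.2.2 (y, ν) = mulVecCLM (N.k12 x y θ ν)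
  b11_k2 : ∀ x θ, (K.2.2.2.2.2 (x, θ)).1 = mulVecCLM (B.b11.k2 x θ)
  d12 : ∀ x y θ, (K.2.2.2.2.2 (x, θ)).2.1 y = mulVecCLM (D.d12 x y θ)
  e12 : ∀ x y θ, (K.2.2.2.2.2 (x, θ)).2.2.1 y = mulVecCLM (E.e12 x y θ)
  k20 : ∀ x y θ, (K.2.2.2.2.2 (x, θ)).2.2.2.1 y = mulVecCLM (N.k20 x y θ)
  k21 : ∀ x y θ ν, (K.2.2.2.2.2 (x, θ)).2.2.2.2.1 (y, ν) = mulVecCLM (N.k21 x y θ ν)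
  k22 : ∀ x y θ ν, (K.2.2.2.2.2 (x, θ)).2.2.2.2.2 (y, ν) = mulVecCLM (N.k22 x y θ ν)

theorem exists_vecRep {m0 m1 m2 : ℕ} (v : Fin m0 → ℝ) {u1 u2 : ℝ → Fin m1 → ℝ}
    {u : ℝ → ℝ → Fin m2 → ℝ} (hu1 : ContinuousOn u1 (Icc a b)) (hu2 : ContinuousOn u2 (Icc c d))
    (hu : ContinuousOn (fun q : ℝ × ℝ => u q.1 q.2) (Icc a b ×ˢ Icc c d)) :
    ∃ U : RectSpace a b c d ((m0, m1), (m1, m2)), VecRep v u1 u2 u U :=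
  ⟨((v, ⟨fun y => u2 y, hu2.domRestrict⟩),
    (⟨fun x => u1 x, hu1.domRestrict⟩ : C(Icc a b, Fin m1 → ℝ)).prodMk
      (ContinuousMap.curry ⟨fun z : Icc a b × Icc c d => u z.1 z.2,
        hu.comp_continuous (f := fun z : Icc a b × Icc c d => ((z.1 : ℝ), (z.2 : ℝ)))
          (by fun_prop) (fun z => ⟨z.1.2, z.2.2⟩)⟩)),
    ⟨rfl, fun _ => rfl, fun _ => rfl, fun _ _ => rfl⟩⟩

theorem exists_kerRep {n0 n1 n2 m0 m1 m2 : ℕ} {B : PI011K n0 n1 m0 m1}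
    {D : PI2Dto011K n0 n1 m2} {E : PI011to2DK n2 m0 m1} {N : PI2DK n2 m2}
    (hB : B.IsCont a b c d) (hD : D.IsCont a b c d)
    (hE : E.IsCont a b c d) (hN : N.IsCont a b c d) :
    ∃ K : RectKernel a b c d ((n0, n1), (n1, n2)) ((m0, m1), (m1, m2)), KerRep B D E N K := by
  obtain ⟨hb01, hb02, hb10, hb20, hb12, hb21, ⟨hb11_k0, hb11_k1, hb11_k2⟩,
    hb22_k0, hb22_k1, hb22_k2⟩ := hB
  obtain ⟨hd0, hd10, hd11, hd12, hd20, hd21, hd22⟩ := hD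
  obtain ⟨he0, he10, he11, he12, he20, he21, he22⟩ := hE
  obtain ⟨hk00, hk10, hk20, hk01, hk02, hk11, hk21, hk12, hk22⟩ := hN
  refine ⟨((mulVecCLM B.b00,
   ofKer hb02 (fun z => z),
   ofKer hb20 (fun z => z),
   ofKer hb22_k0 (fun z => z),
   ofKer hb22_k1 (fun z => (z.1, z.2)),
   ofKer hb22_k2 (fun z => (z.1, z.2))),
  pairKernelMap
    (ofKer hb01 (fun z => z))
    (ofKer hd0 (fun z => (z.1, z.2)))
    (ofKer hb21 (fun z => (z.2, z.1)))
    (ofKer hd20 (fun z => (z.1, z.2)))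
    (ofKer hd21 (fun z => (z.1, z.2.1, z.2.2)))
    (ofKer hd22 (fun z => (z.1, z.2.1, z.2.2))),
  pairKernelMap
    (ofKer hb10 (fun z => z))
    (ofKer hb12 (fun z => (z.1, z.2)))
    (ofKer he0 (fun z => (z.1, z.2)))
    (ofKer he20 (fun z => (z.1, z.2)))
    (ofKer he21 (fun z => (z.1, z.2.1, z.2.2)))
    (ofKer he22 (fun z => (z.1, z.2.1, z.2.2))),
  pairKernelMap
    (ofKer hb11_k0 (fun z => z))
    (ofKer hd10 (fun z => (z.1, z.2)))
    (ofKer he10 (fun z => (z.1, z.2)))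
    (ofKer hk00 (fun z => (z.1, z.2)))
    (ofKer hk01 (fun z => (z.1, z.2.1, z.2.2)))
    (ofKer hk02 (fun z => (z.1, z.2.1, z.2.2))),
  pairKernelMap
    (ofKer hb11_k1 (fun z => (z.1, z.2)))
    (ofKer hd11 (fun z => (z.1.1, z.2, z.1.2)))
    (ofKer he11 (fun z => (z.1.1, z.2, z.1.2)))
    (ofKer hk10 (fun z => (z.1.1, z.2, z.1.2)))
    (ofKer hk11 (fun z => (z.1.1, z.2.1, z.1.2, z.2.2)))
    (ofKer hk12 (fun z => (z.1.1, z.2.1, z.1.2, z.2.2))),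
  pairKernelMap
    (ofKer hb11_k2 (fun z => (z.1, z.2)))
    (ofKer hd12 (fun z => (z.1.1, z.2, z.1.2)))
    (ofKer he12 (fun z => (z.1.1, z.2, z.1.2)))
    (ofKer hk20 (fun z => (z.1.1, z.2, z.1.2)))
    (ofKer hk21 (fun z => (z.1.1, z.2.1, z.1.2, z.2.2)))
    (ofKer hk22 (fun z => (z.1.1, z.2.1, z.1.2, z.2.2)))), ?_⟩
  constructor <;> intros <;> rfl

theorem exists_isCont_kerRep {n0 n1 n2 m0 m1 m2 : ℕ} (hab : a ≤ b) (hcd : c ≤ d)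
    (K : RectKernel a b c d ((n0, n1), (n1, n2)) ((m0, m1), (m1, m2))) :
    ∃ (B : PI011K n0 n1 m0 m1) (D : PI2Dto011K n0 n1 m2)
      (E : PI011to2DK n2 m0 m1) (N : PI2DK n2 m2),
      B.IsCont a b c d ∧ D.IsCont a b c d ∧ E.IsCont a b c d ∧ N.IsCont a b c d ∧
      KerRep B D E N K := by
  let P := projIcc a b hab
  let Q := projIcc c d hcd
  have hP : Continuous P := continuous_projIcc
  have hQ : Continuous Q := continuous_projIcc
  let B : PI011K n0 n1 m0 m1 := {
  b00 := toMat (K.1.1)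
  b01 := fun x => toMat ((K.2.1 (P x)).1)
  b02 := fun y => toMat (K.1.2.1 (Q y))
  b10 := fun x => toMat ((K.2.2.1 (P x)).1)
  b20 := fun y => toMat (K.1.2.2.1 (Q y))
  b12 := fun x y => toMat ((K.2.2.1 (P x)).2.1 (Q y))
  b21 := fun y x => toMat ((K.2.1 (P x)).2.2.1 (Q y))
  b11 :=
    { k0 := fun x => toMat ((K.2.2.2.1 (P x)).1)
      k1 := fun x θ => toMat ((K.2.2.2.2.1 (P x, P θ)).1)
      k2 := fun x θ => toMat ((K.2.2.2.2.2 (P x, P θ)).1) }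
  b22 :=
    { k0 := fun y => toMat (K.1.2.2.2.1 (Q y))
      k1 := fun y ν => toMat (K.1.2.2.2.2.1 (Q y, Q ν))
      k2 := fun y ν => toMat (K.1.2.2.2.2.2 (Q y, Q ν)) }
  }
  let D : PI2Dto011K n0 n1 m2 := {
  d0 := fun x y => toMat ((K.2.1 (P x)).2.1 (Q y))
  d10 := fun x y => toMat ((K.2.2.2.1 (P x)).2.1 (Q y))
  d11 := fun x y θ => toMat ((K.2.2.2.2.1 (P x, P θ)).2.1 (Q y))
  d12 := fun x y θ => toMat ((K.2.2.2.2.2 (P x, P θ)).2.1 (Q y))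
  d20 := fun x y => toMat ((K.2.1 (P x)).2.2.2.1 (Q y))
  d21 := fun x y ν => toMat ((K.2.1 (P x)).2.2.2.2.1 (Q y, Q ν))
  d22 := fun x y ν => toMat ((K.2.1 (P x)).2.2.2.2.2 (Q y, Q ν))
  }
  let E : PI011to2DK n2 m0 m1 := {
  e0 := fun x y => toMat ((K.2.2.1 (P x)).2.2.1 (Q y))
  e10 := fun x y => toMat ((K.2.2.2.1 (P x)).2.2.1 (Q y))
  e11 := fun x y θ => toMat ((K.2.2.2.2.1 (P x, P θ)).2.2.1 (Q y))
  e12 := fun x y θ => toMat ((K.2.2.2.2.2 (P x, P θ)).2.2.1 (Q y))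
  e20 := fun x y => toMat ((K.2.2.1 (P x)).2.2.2.1 (Q y))
  e21 := fun x y ν => toMat ((K.2.2.1 (P x)).2.2.2.2.1 (Q y, Q ν))
  e22 := fun x y ν => toMat ((K.2.2.1 (P x)).2.2.2.2.2 (Q y, Q ν))
  }
  let N : PI2DK n2 m2 := {
  k00 := fun x y => toMat ((K.2.2.2.1 (P x)).2.2.2.1 (Q y))
  k10 := fun x y θ => toMat ((K.2.2.2.2.1 (P x, P θ)).2.2.2.1 (Q y))
  k20 := fun x y θ => toMat ((K.2.2.2.2.2 (P x, P θ)).2.2.2.1 (Q y))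
  k01 := fun x y ν => toMat ((K.2.2.2.1 (P x)).2.2.2.2.1 (Q y, Q ν))
  k02 := fun x y ν => toMat ((K.2.2.2.1 (P x)).2.2.2.2.2 (Q y, Q ν))
  k11 := fun x y θ ν => toMat ((K.2.2.2.2.1 (P x, P θ)).2.2.2.2.1 (Q y, Q ν))
  k21 := fun x y θ ν => toMat ((K.2.2.2.2.2 (P x, P θ)).2.2.2.2.1 (Q y, Q ν))
  k12 := fun x y θ ν => toMat ((K.2.2.2.2.1 (P x, P θ)).2.2.2.2.2 (Q y, Q ν))
  k22 := fun x y θ ν => toMat ((K.2.2.2.2.2 (P x, P θ)).2.2.2.2.2 (Q y, Q ν))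
  }
  refine ⟨B, D, E, N, ?_, ?_, ?_, ?_, ?_⟩
  · refine ⟨?_, ?_, ?_, ?_, ?_, ?_, ⟨?_, ?_, ?_⟩, ?_, ?_, ?_⟩ <;>
      exact Continuous.continuousOn (by dsimp only [B]; fun_prop)
  · refine ⟨?_, ?_, ?_, ?_, ?_, ?_, ?_⟩ <;>
      exact Continuous.continuousOn (by dsimp only [D]; fun_prop)
  · refine ⟨?_, ?_, ?_, ?_, ?_, ?_, ?_⟩ <;>
      exact Continuous.continuousOn (by dsimp only [E]; fun_prop)
  · refine ⟨?_, ?_, ?_, ?_, ?_, ?_, ?_, ?_, ?_⟩ <;>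
      exact Continuous.continuousOn (by dsimp only [N]; fun_prop)
  · constructor <;> intros <;>
      simp only [B, D, E, N, P, Q, projIcc_val, mulVecCLM_toMat]

theorem coe_projIcc_of_mem {s t θ : ℝ} (h : s ≤ t) (hθ : θ ∈ Icc s t) :
    (projIcc s t h θ : ℝ) = θ := by
  rw [projIcc_of_mem h hθ]

theorem vecRep_rect_act {n0 n1 n2 m0 m1 m2 : ℕ} (hab : a ≤ b) (hcd : c ≤ d)
    {B : PI011K n0 n1 m0 m1} {D : PI2Dto011K n0 n1 m2} {E : PI011to2DK n2 m0 m1}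
    {N : PI2DK n2 m2} {K : RectKernel a b c d ((n0, n1), (n1, n2)) ((m0, m1), (m1, m2))}
    (hK : KerRep B D E N K) {v : Fin m0 → ℝ} {u1 u2 : ℝ → Fin m1 → ℝ}
    {u : ℝ → ℝ → Fin m2 → ℝ} {U : RectSpace a b c d ((m0, m1), (m1, m2))}
    (hU : VecRep v u1 u2 u U) :
    VecRep (PI0112 a b c d B D E N v u1 u2 u).1 (PI0112 a b c d B D E N v u1 u2 u).2.1
      (PI0112 a b c d B D E N v u1 u2 u).2.2.1 (PI0112 a b c d B D E N v u1 u2 u).2.2.2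
      ((KernelSystem.rect hab hcd).act K U) := by
  have ha : a ∈ Icc a b := left_mem_Icc.2 hab
  have hb : b ∈ Icc a b := right_mem_Icc.2 hab
  have hc : c ∈ Icc c d := left_mem_Icc.2 hcd
  have hd : d ∈ Icc c d := right_mem_Icc.2 hcd
  constructor
  · refine (KernelSystem.base.pair_pairAct_fst_fst hab hcd K U).trans ?_
    simp only [PI0112, PI011, PI2Dto011]
    repeat' first
      | refine congrArg₂ (· + ·) ?_ ?_
      | refine integral_congr_of_mem_Icc (by assumption) (by assumption) fun θ hθ => ?_
      | simp (disch := assumption) only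
        [KernelSystem.base, coe_projIcc_of_mem, mulVecCLM_apply, hU.fst_fst, hU.snd_fst,
        hU.fst_snd, hU.snd_snd, hK.b00, hK.b01, hK.b02, hK.d0]
  · intro x
    have hx := x.2
    refine (KernelSystem.base.pair_pairAct_snd_fst hab hcd K U x).trans ?_
    simp only [PI0112, PI011, PI2Dto011, PI1D, Pi.add_apply]
    repeat' first
      | refine congrArg₂ (· + ·) ?_ ?_
      | refine integral_congr_of_mem_Icc (by assumption) (by assumption) fun θ hθ => ?_
      | simp (disch := assumption) only
        [KernelSystem.base, coe_projIcc_of_mem, mulVecCLM_apply, hU.fst_fst, hU.snd_fst,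
        hU.fst_snd, hU.snd_snd, hK.b10, hK.b11_k0, hK.b11_k1, hK.b11_k2, hK.b12, hK.d10,
        hK.d11, hK.d12]
  · intro y
    have hy := y.2
    refine (KernelSystem.base.pair_pairAct_fst_snd hab hcd K U y).trans ?_
    simp only [PI0112, PI011, PI2Dto011, PI1D, Pi.add_apply]
    repeat' first
      | refine congrArg₂ (· + ·) ?_ ?_
      | refine integral_congr_of_mem_Icc (by assumption) (by assumption) fun θ hθ => ?_
      | simp (disch := assumption) only
        [KernelSystem.base, coe_projIcc_of_mem, mulVecCLM_apply, hU.fst_fst, hU.snd_fst,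
        hU.fst_snd, hU.snd_snd, hK.b20, hK.b21, hK.b22_k0, hK.b22_k1, hK.b22_k2, hK.d20,
        hK.d21, hK.d22]
  · intro x y
    have hx := x.2
    have hy := y.2
    refine (KernelSystem.base.pair_pairAct_snd_snd hab hcd K U x y).trans ?_
    simp only [PI0112, PI011to2D, PI2D]
    repeat' first
      | refine congrArg₂ (· + ·) ?_ ?_
      | refine integral_congr_of_mem_Icc (by assumption) (by assumption) fun θ hθ => ?_
      | simp (disch := assumption) only
        [KernelSystem.base, coe_projIcc_of_mem, mulVecCLM_apply, hU.fst_fst, hU.snd_fst,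
        hU.fst_snd, hU.snd_snd, hK.e0, hK.e10, hK.e11, hK.e12, hK.e20, hK.e21, hK.e22, hK.k00,
        hK.k10, hK.k20, hK.k01, hK.k02, hK.k11, hK.k21, hK.k12, hK.k22]

end Unbundled

/-- 0112-PI operators are closed under composition. -/
theorem composition_of_0112_PI_operators
    {n0 n1 n2 p0 p1 p2 m0 m1 m2 : ℕ} (a b c d : ℝ)
    (hab : a < b) (hcd : c < d)
    (B : PI011K n0 n1 p0 p1) (D : PI2Dto011K n0 n1 p2)
    (E : PI011to2DK n2 p0 p1) (N : PI2DK n2 p2)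
    (B' : PI011K p0 p1 m0 m1) (D' : PI2Dto011K p0 p1 m2)
    (E' : PI011to2DK p2 m0 m1) (N' : PI2DK p2 m2)
    (hB : B.IsCont a b c d) (hD : D.IsCont a b c d)
    (hE : E.IsCont a b c d) (hN : N.IsCont a b c d)
    (hB' : B'.IsCont a b c d) (hD' : D'.IsCont a b c d)
    (hE' : E'.IsCont a b c d) (hN' : N'.IsCont a b c d) :
    ∃ (B'' : PI011K n0 n1 m0 m1) (D'' : PI2Dto011K n0 n1 m2)
      (E'' : PI011to2DK n2 m0 m1) (N'' : PI2DK n2 m2),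
      B''.IsCont a b c d ∧ D''.IsCont a b c d ∧
      E''.IsCont a b c d ∧ N''.IsCont a b c d ∧
      ∀ (v : Fin m0 → ℝ) (u1 u2 : ℝ → Fin m1 → ℝ) (u : ℝ → ℝ → Fin m2 → ℝ),
        ContinuousOn u1 (Icc a b) → ContinuousOn u2 (Icc c d) →
        ContinuousOn (fun q : ℝ × ℝ => u q.1 q.2) (Icc a b ×ˢ Icc c d) →
        ∀ (w : Fin p0 → ℝ) (w1 w2 : ℝ → Fin p1 → ℝ) (wf : ℝ → ℝ → Fin p2 → ℝ),
          (w, w1, w2, wf) = PI0112 a b c d B' D' E' N' v u1 u2 u →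
          (PI0112 a b c d B D E N w w1 w2 wf).1
              = (PI0112 a b c d B'' D'' E'' N'' v u1 u2 u).1 ∧
          (∀ x ∈ Icc a b,
            (PI0112 a b c d B D E N w w1 w2 wf).2.1 x
              = (PI0112 a b c d B'' D'' E'' N'' v u1 u2 u).2.1 x) ∧
          (∀ y ∈ Icc c d,
            (PI0112 a b c d B D E N w w1 w2 wf).2.2.1 y
              = (PI0112 a b c d B'' D'' E'' N'' v u1 u2 u).2.2.1 y) ∧
          (∀ x ∈ Icc a b, ∀ y ∈ Icc c d,
            (PI0112 a b c d B D E N w w1 w2 wf).2.2.2 x y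
              = (PI0112 a b c d B'' D'' E'' N'' v u1 u2 u).2.2.2 x y) := by
  obtain ⟨K, hK⟩ := exists_kerRep hB hD hE hN
  obtain ⟨K', hK'⟩ := exists_kerRep hB' hD' hE' hN'
  obtain ⟨B'', D'', E'', N'', hB'', hD'', hE'', hN'', hK''⟩ :=
    exists_isCont_kerRep hab.le hcd.le ((KernelSystem.rect hab.le hcd.le).comp K K')
  refine ⟨B'', D'', E'', N'', hB'', hD'', hE'', hN'', ?_⟩
  intro v u1 u2 u hu1 hu2 hu w w1 w2 wf hw
  obtain ⟨U, hU⟩ := exists_vecRep v hu1 hu2 hu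
  have hW := vecRep_rect_act hab.le hcd.le hK' hU
  rw [← hw] at hW
  have hl := vecRep_rect_act hab.le hcd.le hK hW
  have hr := vecRep_rect_act hab.le hcd.le hK'' hU
  rw [KernelSystem.act_comp] at hr
  exact ⟨hl.fst_fst.symm.trans hr.fst_fst,
    fun x hx => (hl.snd_fst ⟨x, hx⟩).symm.trans (hr.snd_fst ⟨x, hx⟩),
    fun y hy => (hl.fst_snd ⟨y, hy⟩).symm.trans (hr.fst_snd ⟨y, hy⟩),
    fun x hx y hy => (hl.snd_snd ⟨x, hx⟩ ⟨y, hy⟩).symm.trans (hr.snd_snd ⟨x, hx⟩ ⟨y, hy⟩)⟩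
end
end
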